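/- arXiv:math/0012111 — 6 statements merged into one kernel-verified Lean document; each statement's English description precedes it below -/
import Mathlib

section
/- For every n ≥ 1, the polynomials A_n(t,q) satisfy the recursion A_n(t,q) = (1 + tq·[n−1]_q)·A_{n−1}(t,q) + tq(1−t)·δ_t(A_{n−1}(t,q)). -/
open Finset

/-- `π` is an element of the hyperoctahedral group `B_n`: a bijection of `ℤ`
satisfying `π (-a) = -π a` for all `a`, and fixing every `a` with `|a| > n`
(so it restricts to a bijection of `{-n,…,-1,1,…,n}`). -/
def IsSignedPerm (n : ℕ) (π : Equiv.Perm ℤ) : Prop :=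
  (∀ a : ℤ, π (-a) = - π a) ∧ ∀ a : ℤ, (n : ℤ) < |a| → π a = a

/-- The hyperoctahedral group `B_n`, as a set of permutations of `ℤ`. -/
def BSet (n : ℕ) : Set (Equiv.Perm ℤ) := {π | IsSignedPerm n π}

/-- The descent set `Des_A(π) = {i ∈ [n-1] : π(i) > π(i+1)}`. -/
def DesA (n : ℕ) (π : Equiv.Perm ℤ) : Finset ℕ :=
  (Finset.Icc 1 (n - 1)).filter fun i => π ((i : ℤ) + 1) < π (i : ℤ)

/-- `des_A(π)`, the number of descents of the window `π(1),…,π(n)`. -/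
def desA (n : ℕ) (π : Equiv.Perm ℤ) : ℕ := (DesA n π).card

/-- `maj_A(π) = Σ_{i : π(i) > π(i+1)} i`. -/
def majA (n : ℕ) (π : Equiv.Perm ℤ) : ℕ := ∑ i ∈ DesA n π, i

/-- `Neg(π) = {i ∈ [n] : π(i) < 0}`. -/
def NegSet (n : ℕ) (π : Equiv.Perm ℤ) : Finset ℕ :=
  (Finset.Icc 1 n).filter fun i => π (i : ℤ) < 0

/-- `neg(π) = |Neg(π)|`. -/
def negStat (n : ℕ) (π : Equiv.Perm ℤ) : ℕ := (NegSet n π).card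

/-- `-Σ_{i ∈ Neg(π)} π(i) = Σ_{i ∈ Neg(π)} |π(i)|`, as a natural number. -/
def negSum (n : ℕ) (π : Equiv.Perm ℤ) : ℕ := ∑ i ∈ NegSet n π, (π (i : ℤ)).natAbs

/-- `inv(π) = #{(i,j) : 1 ≤ i < j ≤ n, π(i) > π(j)}`. -/
def invStat (n : ℕ) (π : Equiv.Perm ℤ) : ℕ :=
  (((Finset.Icc 1 n) ×ˢ (Finset.Icc 1 n)).filter
    (fun p => p.1 < p.2 ∧ π ((p.2 : ℕ) : ℤ) < π ((p.1 : ℕ) : ℤ))).card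

/-- The Coxeter length `ℓ(π) = inv(π) - Σ_{i ∈ Neg(π)} π(i)`. -/
def lenB (n : ℕ) (π : Equiv.Perm ℤ) : ℕ := invStat n π + negSum n π

/-- The negative major index `nmaj(π) = maj_A(π) - Σ_{i ∈ Neg(π)} π(i)`. -/
def nmaj (n : ℕ) (π : Equiv.Perm ℤ) : ℕ := majA n π + negSum n π

/-- The negative descent number `ndes(π) = des_A(π) + neg(π)`. -/
def ndes (n : ℕ) (π : Equiv.Perm ℤ) : ℕ := desA n π + negStat n π

/-- The flag major index `fmaj(π) = 2 maj_A(π) + neg(π)`. -/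
def fmaj (n : ℕ) (π : Equiv.Perm ℤ) : ℕ := 2 * majA n π + negStat n π

/-- The flag descent number `fd(π) = 2 des_A(π) + ε₁(π)`. -/
def fd (n : ℕ) (π : Equiv.Perm ℤ) : ℕ :=
  2 * desA n π + (if π 1 < 0 then 1 else 0)

/-- The symmetric group `S_n`, embedded in `B_n` as the signed permutations
with all window entries positive. -/
def SnSet (n : ℕ) : Set (Equiv.Perm ℤ) :=
  {π | IsSignedPerm n π ∧ ∀ i ∈ Finset.Icc 1 n, 0 < π (i : ℤ)}

/-- `T = {π ∈ B_n : des_A(π) = 0}`. -/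
def TSet (n : ℕ) : Set (Equiv.Perm ℤ) :=
  {π | IsSignedPerm n π ∧ desA n π = 0}

/-- The `q`-analogue `[m]_q = 1 + q + ⋯ + q^{m-1}` in `ℚ[q]`. -/
noncomputable def qnumQ (m : ℕ) : Polynomial ℚ := ∑ j ∈ Finset.range m, Polynomial.X ^ j

/-- `A_n(t,q) = Σ_{σ ∈ S_n} t^{des(σ)} q^{maj(σ)}`, as an element of `ℚ[q][t]`
(outer variable `t`, inner variable `q`). -/
noncomputable def An (n : ℕ) : Polynomial (Polynomial ℚ) :=
  ∑ᶠ σ ∈ SnSet n, (Polynomial.X : Polynomial (Polynomial ℚ)) ^ desA n σ *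
    Polynomial.C (Polynomial.X ^ majA n σ)

/-- Precomposing with `insertCycle m p` inserts the letter in position `m + 1` of a window right
after position `p`. -/
def insertCycle (m : ℕ) (p : Fin (m + 1)) : Equiv.Perm ℤ where
  toFun i :=
    if i = p + 1 then m + 1
    else if i = -(p + 1) then -(m + 1)
    else if (p : ℤ) + 1 < i ∧ i ≤ m + 1 then i - 1
    else if -((m : ℤ) + 1) ≤ i ∧ i < -(p + 1) then i + 1
    else i
  invFun i :=
    if i = m + 1 then p + 1
    else if i = -(m + 1) then -(p + 1)
    else if (p : ℤ) + 1 ≤ i ∧ i ≤ m then i + 1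
    else if -(m : ℤ) ≤ i ∧ i ≤ -(p + 1) then i - 1
    else i
  left_inv i := by
    have := p.is_lt
    dsimp only
    split_ifs <;> omega
  right_inv i := by
    have := p.is_lt
    dsimp only
    split_ifs <;> omega

lemma insertCycle_apply (m : ℕ) (p : Fin (m + 1)) (i : ℤ) : insertCycle m p i =
    if i = p + 1 then (m + 1 : ℤ)
    else if i = -(p + 1) then -(m + 1)
    else if (p : ℤ) + 1 < i ∧ i ≤ m + 1 then i - 1
    else if -((m : ℤ) + 1) ≤ i ∧ i < -(p + 1) then i + 1
    else i := rfl

lemma insertCycle_inv_apply (m : ℕ) (p : Fin (m + 1)) (i : ℤ) : (insertCycle m p)⁻¹ i =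
    if i = m + 1 then (p + 1 : ℤ)
    else if i = -(m + 1) then -(p + 1)
    else if (p : ℤ) + 1 ≤ i ∧ i ≤ m then i + 1
    else if -(m : ℤ) ≤ i ∧ i ≤ -(p + 1) then i - 1
    else i := rfl

lemma insertCycle_neg (m : ℕ) (p : Fin (m + 1)) (i : ℤ) :
    insertCycle m p (-i) = -insertCycle m p i := by
  have := p.is_lt
  simp only [insertCycle_apply]
  split_ifs <;> omega

lemma insertCycle_inv_neg (m : ℕ) (p : Fin (m + 1)) (i : ℤ) :
    (insertCycle m p)⁻¹ (-i) = -(insertCycle m p)⁻¹ i := by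
  have := p.is_lt
  simp only [insertCycle_inv_apply]
  split_ifs <;> omega

lemma apply_pos_of_mem_SnSet {m : ℕ} {σ : Equiv.Perm ℤ} (hσ : σ ∈ SnSet m) {i : ℤ}
    (hi : 0 < i) : 0 < σ i := by
  by_cases h : i ≤ m
  · have := hσ.2 i.toNat (Finset.mem_Icc.2 (by omega))
    rwa [Int.toNat_of_nonneg hi.le] at this
  · rwa [hσ.1.2 i (by rw [abs_of_pos hi]; omega)]

lemma apply_of_lt_of_mem_SnSet {m : ℕ} {σ : Equiv.Perm ℤ} (hσ : σ ∈ SnSet m) {i : ℤ}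
    (hi : (m : ℤ) < i) : σ i = i :=
  hσ.1.2 i (hi.trans_le (le_abs_self i))

lemma apply_le_of_mem_SnSet {m : ℕ} {σ : Equiv.Perm ℤ} (hσ : σ ∈ SnSet m) {i : ℤ}
    (hi : i ≤ m) : σ i ≤ m := by
  by_contra! h
  have := σ.injective (apply_of_lt_of_mem_SnSet hσ h)
  omega

lemma mul_insertCycle_mem_SnSet {m : ℕ} {σ : Equiv.Perm ℤ} (hσ : σ ∈ SnSet m)
    (p : Fin (m + 1)) : σ * insertCycle m p ∈ SnSet (m + 1) := by
  have hp := p.is_lt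
  refine ⟨⟨fun a => ?_, fun a ha => ?_⟩, fun i hi => ?_⟩
  · rw [Equiv.Perm.mul_apply, Equiv.Perm.mul_apply, insertCycle_neg, hσ.1.1]
  · have h : insertCycle m p a = a := by
      rw [insertCycle_apply]
      push_cast at ha
      split_ifs <;> grind
    rw [Equiv.Perm.mul_apply, h]
    exact hσ.1.2 a (by push_cast at ha; omega)
  · refine apply_pos_of_mem_SnSet hσ ?_
    rw [Finset.mem_Icc] at hi
    rw [insertCycle_apply]
    split_ifs <;> omega

lemma insertCycle_apply_succ (m : ℕ) (p : Fin (m + 1)) :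
    insertCycle m p (p + 1) = m + 1 := by
  simp [insertCycle_apply]

lemma mul_insertCycle_injective {m : ℕ} {σ σ' : Equiv.Perm ℤ} (hσ : σ ∈ SnSet m)
    (hσ' : σ' ∈ SnSet m) {p p' : Fin (m + 1)}
    (h : σ * insertCycle m p = σ' * insertCycle m p') : σ = σ' ∧ p = p' := by
  have h1 : (σ * insertCycle m p) (p + 1) = m + 1 := by
    rw [Equiv.Perm.mul_apply, insertCycle_apply_succ, apply_of_lt_of_mem_SnSet hσ (by omega)]
  have h2 : (σ' * insertCycle m p') (p' + 1) = m + 1 := by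
    rw [Equiv.Perm.mul_apply, insertCycle_apply_succ, apply_of_lt_of_mem_SnSet hσ' (by omega)]
  rw [h, ← h2] at h1
  have h3 := (σ' * insertCycle m p').injective h1
  obtain rfl : p = p' := Fin.ext (by omega)
  exact ⟨mul_right_cancel h, rfl⟩

lemma exists_mul_insertCycle_eq {m : ℕ} {τ : Equiv.Perm ℤ} (hτ : τ ∈ SnSet (m + 1)) :
    ∃ σ ∈ SnSet m, ∃ p, σ * insertCycle m p = τ := by
  obtain ⟨x, hx⟩ := τ.surjective ((m : ℤ) + 1)
  have hx0 : 0 < x := by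
    by_contra! h
    rcases h.lt_or_eq with h | rfl
    · have h1 := apply_pos_of_mem_SnSet hτ (neg_pos.2 h)
      rw [hτ.1.1] at h1
      omega
    · have := hτ.1.1 0
      rw [neg_zero] at this
      omega
  have hx1 : x ≤ m + 1 := by
    by_contra! h
    have := apply_of_lt_of_mem_SnSet hτ (i := x) (by push_cast; omega)
    omega
  obtain ⟨p, hp⟩ : ∃ p : Fin (m + 1), (p : ℤ) + 1 = x :=
    ⟨⟨(x - 1).toNat, by omega⟩, by simp only; omega⟩
  have hpm := p.is_lt
  refine ⟨τ * (insertCycle m p)⁻¹, ⟨⟨fun a => ?_, fun a ha => ?_⟩, fun i hi => ?_⟩, p, by simp⟩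
  · rw [Equiv.Perm.mul_apply, Equiv.Perm.mul_apply, insertCycle_inv_neg, hτ.1.1]
  · rw [Equiv.Perm.mul_apply, insertCycle_inv_apply]
    by_cases h1 : a = m + 1
    · rw [if_pos h1, hp, hx, h1]
    by_cases h2 : a = -(m + 1)
    · rw [if_neg h1, if_pos h2, hτ.1.1, hp, hx, h2]
    have h3 : ((m + 1 : ℕ) : ℤ) < |a| := by
      push_cast
      grind
    rw [if_neg h1, if_neg h2, if_neg (by grind), if_neg (by grind), hτ.1.2 a h3]
  · refine apply_pos_of_mem_SnSet hτ ?_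
    rw [Finset.mem_Icc] at hi
    rw [insertCycle_inv_apply]
    split_ifs <;> omega

lemma finite_SnSet (m : ℕ) : (SnSet m).Finite := by
  induction m with
  | zero =>
    refine (Set.finite_singleton 1).subset fun σ hσ => Equiv.ext fun a => ?_
    by_cases ha : a = 0
    · have := hσ.1.1 0
      rw [neg_zero] at this
      rw [ha, Equiv.Perm.one_apply]
      omega
    · exact hσ.1.2 a (by simpa using ha)
  | succ m ih =>
    refine (ih.image2 (fun σ p => σ * insertCycle m p) Set.finite_univ).subset fun τ hτ => ?_
    obtain ⟨σ, hσ, p, h⟩ := exists_mul_insertCycle_eq hτ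
    exact ⟨σ, hσ, p, Set.mem_univ p, h⟩

lemma mem_DesA {m : ℕ} {σ : Equiv.Perm ℤ} {i : ℕ} :
    i ∈ DesA m σ ↔ (1 ≤ i ∧ i ≤ m - 1) ∧ σ ((i : ℤ) + 1) < σ i := by
  rw [DesA, Finset.mem_filter, Finset.mem_Icc]

lemma DesA_subset_range (m : ℕ) (σ : Equiv.Perm ℤ) : DesA m σ ⊆ Finset.range m := by
  intro i hi
  rw [mem_DesA] at hi
  rw [Finset.mem_range]
  omega

lemma DesA_mul_insertCycle_last {m : ℕ} {σ : Equiv.Perm ℤ} (hσ : σ ∈ SnSet m) :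
    DesA (m + 1) (σ * insertCycle m (Fin.last m)) = DesA m σ := by
  have h1 : ∀ i : ℤ, 0 < i → insertCycle m (Fin.last m) i = i := by
    intro i hi
    simp only [insertCycle_apply, Fin.val_last]
    split_ifs <;> omega
  ext i
  simp only [mem_DesA, Equiv.Perm.mul_apply]
  constructor
  · rintro ⟨hi, h⟩
    rw [h1 _ (by omega), h1 _ (by omega)] at h
    have : i ≠ m := by
      rintro rfl
      have h2 := apply_le_of_mem_SnSet hσ (le_refl (i : ℤ))
      rw [apply_of_lt_of_mem_SnSet hσ (lt_add_one (i : ℤ))] at h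
      omega
    exact ⟨by omega, h⟩
  · rintro ⟨hi, h⟩
    rw [h1 _ (by omega), h1 _ (by omega)]
    exact ⟨by omega, h⟩

lemma DesA_mul_insertCycle_castSucc {m : ℕ} {σ : Equiv.Perm ℤ} (hσ : σ ∈ SnSet m) (p : Fin m) :
    DesA (m + 1) (σ * insertCycle m p.castSucc) =
      (DesA m σ).filter (· < (p : ℕ)) ∪
        insert ((p : ℕ) + 1) (((DesA m σ).filter ((p : ℕ) < ·)).image (· + 1)) := by
  have hp := p.is_lt
  have hlt : ∀ i : ℤ, 0 < i → i < p + 1 → insertCycle m p.castSucc i = i := by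
    intro i h0 hi
    simp only [insertCycle_apply, Fin.val_castSucc]
    split_ifs <;> omega
  have heq : insertCycle m p.castSucc (p + 1) = m + 1 := insertCycle_apply_succ m p.castSucc
  have hgt : ∀ i : ℤ, (p : ℤ) + 1 < i → i ≤ m + 1 → insertCycle m p.castSucc i = i - 1 := by
    intro i h0 hi
    simp only [insertCycle_apply, Fin.val_castSucc]
    split_ifs <;> omega
  have htop : σ (m + 1) = m + 1 := apply_of_lt_of_mem_SnSet hσ (by omega)
  ext i
  simp only [mem_DesA, Finset.mem_filter, Equiv.Perm.mul_apply, Finset.mem_union,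
    Finset.mem_insert, Finset.mem_image]
  rcases lt_trichotomy i (p : ℕ) with h | h | h
  · by_cases h0 : 1 ≤ i
    · rw [hlt _ (by omega) (by omega), hlt _ (by omega) (by omega)]
      grind
    · grind
  · subst h
    by_cases h0 : 1 ≤ (p : ℕ)
    · rw [heq, hlt _ (by omega) (by omega), htop]
      have := apply_le_of_mem_SnSet hσ (i := (p : ℕ)) (by omega)
      grind
    · grind
  · rcases Nat.lt_or_eq_of_le (Nat.succ_le_of_lt h) with h' | h'
    · by_cases hm : i ≤ m
      · rw [hgt _ (by omega) (by omega), hgt _ (by omega) (by omega)]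
        obtain ⟨j, rfl⟩ : ∃ j, i = j + 1 := ⟨i - 1, by omega⟩
        have e1 : ((j + 1 : ℕ) : ℤ) + 1 - 1 = (j : ℤ) + 1 := by push_cast; ring
        have e2 : ((j + 1 : ℕ) : ℤ) - 1 = (j : ℤ) := by push_cast; ring
        rw [e1, e2]
        constructor
        · rintro ⟨-, h2⟩
          exact Or.inr (Or.inr ⟨j, ⟨⟨by omega, h2⟩, by omega⟩, rfl⟩)
        · rintro (h2 | h2 | ⟨k, ⟨⟨-, h2⟩, -⟩, h3⟩)
          · omega
          · omega
          · obtain rfl : k = j := by omega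
            exact ⟨by omega, h2⟩
      · grind
    · subst h'
      have e1 : ((Nat.succ (p : ℕ) : ℕ) : ℤ) = (p : ℤ) + 1 := by push_cast; ring
      rw [e1, heq, hgt _ (by omega) (by omega), htop]
      have := apply_le_of_mem_SnSet hσ (i := (p : ℕ) + 1) (by omega)
      constructor
      · intro
        exact Or.inr (Or.inl rfl)
      · intro
        refine ⟨by omega, ?_⟩
        rw [show (p : ℤ) + 1 + 1 - 1 = ((p : ℕ) : ℤ) + 1 by ring]
        omega

section InsertedDescents

variable (S : Finset ℕ) (p : ℕ)

lemma disjoint_filter_lt_insert :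
    Disjoint (S.filter (· < p)) (insert (p + 1) ((S.filter (p < ·)).image (· + 1))) := by
  rw [Finset.disjoint_left]
  intro i hi h
  simp only [Finset.mem_filter, Finset.mem_insert, Finset.mem_image] at hi h
  grind

lemma succ_notMem_image_filter : p + 1 ∉ (S.filter (p < ·)).image (· + 1) := by
  simp

lemma filter_lt_union_filter_gt :
    S.filter (· < p) ∪ S.filter (p < ·) = S.erase p := by
  ext i
  simp only [Finset.mem_union, Finset.mem_filter, Finset.mem_erase]
  grind

lemma disjoint_filter_lt_filter_gt : Disjoint (S.filter (· < p)) (S.filter (p < ·)) := by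
  rw [Finset.disjoint_left]
  intro i hi h
  simp only [Finset.mem_filter] at hi h
  omega

lemma card_filter_lt_union_insert :
    (S.filter (· < p) ∪ insert (p + 1) ((S.filter (p < ·)).image (· + 1))).card =
      (S.erase p).card + 1 := by
  rw [Finset.card_union_of_disjoint (disjoint_filter_lt_insert S p),
    Finset.card_insert_of_notMem (succ_notMem_image_filter S p),
    Finset.card_image_of_injective _ (add_left_injective 1), ← filter_lt_union_filter_gt,
    Finset.card_union_of_disjoint (disjoint_filter_lt_filter_gt S p), add_assoc]

lemma sum_filter_lt_union_insert :
    ∑ i ∈ S.filter (· < p) ∪ insert (p + 1) ((S.filter (p < ·)).image (· + 1)), i =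
      ∑ i ∈ S.erase p, i + (p + 1 + (S.filter (p < ·)).card) := by
  rw [Finset.sum_union (disjoint_filter_lt_insert S p),
    Finset.sum_insert (succ_notMem_image_filter S p),
    Finset.sum_image (fun _ _ _ _ h => add_left_injective 1 h), ← filter_lt_union_filter_gt,
    Finset.sum_union (disjoint_filter_lt_filter_gt S p), Finset.sum_add_distrib]
  simp only [Finset.sum_const, smul_eq_mul, mul_one]
  ring

end InsertedDescents

section GeometricSums

variable {R : Type*} [CommRing R] (q : R)

lemma sum_pow_card_filter_gt (S : Finset ℕ) :
    ∑ p ∈ S, q ^ (S.filter (p < ·)).card = ∑ j ∈ Finset.range S.card, q ^ j := by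
  induction S using Finset.induction_on_min with
  | empty => simp
  | insert a S ha ih =>
    have hn : a ∉ S := fun h => lt_irrefl a (ha a h)
    rw [Finset.sum_insert hn, Finset.card_insert_of_notMem hn, Finset.sum_range_succ, ← ih,
      add_comm]
    congr 1
    · refine Finset.sum_congr rfl fun p hp => ?_
      rw [Finset.filter_insert, if_neg (ha p hp).not_gt]
    · rw [Finset.filter_insert, if_neg (lt_irrefl a), Finset.filter_true_of_mem ha]

lemma sum_pow_card_filter_lt (S : Finset ℕ) :
    ∑ p ∈ S, q ^ (S.filter (· < p)).card = ∑ j ∈ Finset.range S.card, q ^ j := by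
  induction S using Finset.induction_on_max with
  | empty => simp
  | insert a S ha ih =>
    have hn : a ∉ S := fun h => lt_irrefl a (ha a h)
    rw [Finset.sum_insert hn, Finset.card_insert_of_notMem hn, Finset.sum_range_succ, ← ih,
      add_comm]
    congr 1
    · refine Finset.sum_congr rfl fun p hp => ?_
      rw [Finset.filter_insert, if_neg (ha p hp).not_gt]
    · rw [Finset.filter_insert, if_neg (lt_irrefl a), Finset.filter_true_of_mem ha]

lemma add_card_filter_gt_of_notMem {m : ℕ} {S : Finset ℕ} (hS : S ⊆ Finset.range m) {p : ℕ}
    (hp : p ∈ Finset.range m \ S) :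
    p + (S.filter (p < ·)).card =
      S.card + ((Finset.range m \ S).filter (· < p)).card := by
  rw [Finset.mem_sdiff, Finset.mem_range] at hp
  have h1 : (S.filter (· < p)).card + (S.filter (p < ·)).card = S.card := by
    rw [← Finset.card_union_of_disjoint (disjoint_filter_lt_filter_gt S p),
      filter_lt_union_filter_gt, Finset.erase_eq_of_notMem hp.2]
  have h2 : (S.filter (· < p)).card + ((Finset.range m \ S).filter (· < p)).card = p := by
    rw [← Finset.card_union_of_disjoint (Finset.disjoint_filter_filter Finset.disjoint_sdiff),
      ← Finset.filter_union, Finset.union_sdiff_of_subset hS]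
    conv_rhs => rw [← Finset.card_range p]
    congr 1
    ext i
    simp only [Finset.mem_filter, Finset.mem_range]
    omega
  omega

lemma sum_pow_add_card_filter_gt {m : ℕ} {S : Finset ℕ} (hS : S ⊆ Finset.range m) :
    ∑ p ∈ Finset.range m \ S, q ^ (p + (S.filter (p < ·)).card) =
      ∑ j ∈ Finset.range m, q ^ j - ∑ j ∈ Finset.range S.card, q ^ j := by
  have hle : S.card ≤ m := by simpa using Finset.card_le_card hS
  rw [Finset.sum_congr rfl fun p hp => by rw [add_card_filter_gt_of_notMem hS hp, pow_add],
    ← Finset.mul_sum, sum_pow_card_filter_lt, Finset.card_sdiff_of_subset hS, Finset.card_range,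
    eq_sub_iff_add_eq', Finset.mul_sum]
  obtain ⟨k, rfl⟩ := Nat.exists_eq_add_of_le hle
  simp only [Nat.add_sub_cancel_left, Finset.sum_range_add, pow_add]

lemma sum_insert_descent {m : ℕ} {S : Finset ℕ} (hS : S ⊆ Finset.range m) (t : R) :
    ∑ p ∈ Finset.range m, t ^ ((S.erase p).card + 1) *
        q ^ (∑ i ∈ S.erase p, i + (p + 1 + (S.filter (p < ·)).card)) =
      t ^ S.card * q ^ (∑ i ∈ S, i) *
        (q * ∑ j ∈ Finset.range S.card, q ^ j +
          t * q * (∑ j ∈ Finset.range m, q ^ j - ∑ j ∈ Finset.range S.card, q ^ j)) := by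
  rw [← sum_pow_add_card_filter_gt q hS, ← sum_pow_card_filter_gt, ← Finset.sum_sdiff hS,
    mul_add, add_comm]
  congr 1
  · rw [Finset.mul_sum, Finset.mul_sum]
    refine Finset.sum_congr rfl fun p hp => ?_
    rw [Finset.card_erase_add_one hp, ← Finset.sum_erase_add S _ hp]
    ring
  · rw [Finset.mul_sum, Finset.mul_sum]
    refine Finset.sum_congr rfl fun p hp => ?_
    rw [Finset.erase_eq_of_notMem (Finset.mem_sdiff.1 hp).2]
    ring

end GeometricSums

open Polynomial in
lemma sum_mul_insertCycle {m : ℕ} {σ : Equiv.Perm ℤ} (hσ : σ ∈ SnSet m) :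
    ∑ p : Fin (m + 1), (X : ℚ[X][X]) ^ desA (m + 1) (σ * insertCycle m p) *
        C (X ^ majA (m + 1) (σ * insertCycle m p)) =
      X ^ desA m σ * C (X ^ majA m σ) *
        (1 + C X * C (qnumQ (desA m σ)) + X * C X * (C (qnumQ m) - C (qnumQ (desA m σ)))) := by
  have h := sum_insert_descent (C X : ℚ[X][X]) (DesA_subset_range m σ) X
  rw [← Fin.sum_univ_eq_sum_range (fun p => (X : ℚ[X][X]) ^ (((DesA m σ).erase p).card + 1) *
    C X ^ (∑ i ∈ (DesA m σ).erase p, i + (p + 1 + ((DesA m σ).filter (p < ·)).card)))] at h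
  rw [Fin.sum_univ_castSucc]
  simp only [desA, majA, DesA_mul_insertCycle_last hσ, DesA_mul_insertCycle_castSucc hσ,
    card_filter_lt_union_insert, sum_filter_lt_union_insert, qnumQ, C_pow, map_sum]
  rw [h]
  ring

lemma An_eq_sum (m : ℕ) : An m = ∑ σ ∈ (finite_SnSet m).toFinset,
    (Polynomial.X : Polynomial (Polynomial ℚ)) ^ desA m σ *
      Polynomial.C (Polynomial.X ^ majA m σ) :=
  finsum_mem_eq_finite_toFinset_sum _ (finite_SnSet m)

open Polynomial in
lemma An_succ (m : ℕ) : An (m + 1) = ∑ σ ∈ (finite_SnSet m).toFinset,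
    (X : ℚ[X][X]) ^ desA m σ * C (X ^ majA m σ) *
      (1 + C X * C (qnumQ (desA m σ)) + X * C X * (C (qnumQ m) - C (qnumQ (desA m σ)))) := by
  rw [← Finset.sum_congr rfl fun σ hσ =>
      sum_mul_insertCycle ((finite_SnSet m).mem_toFinset.1 hσ),
    ← Finset.sum_product', An_eq_sum]
  symm
  refine Finset.sum_nbij (fun x => x.1 * insertCycle m x.2) ?_ ?_ ?_ fun _ _ => rfl
  · intro x hx
    simp only [Finset.mem_product, Set.Finite.mem_toFinset] at hx ⊢
    exact mul_insertCycle_mem_SnSet hx.1 x.2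
  · intro x hx y hy h
    simp only [Finset.mem_coe, Finset.mem_product, Set.Finite.mem_toFinset] at hx hy
    obtain ⟨h1, h2⟩ := mul_insertCycle_injective hx.1 hy.1 h
    exact Prod.ext h1 h2
  · intro τ hτ
    simp only [Finset.mem_coe, Set.Finite.mem_toFinset] at hτ
    obtain ⟨σ, hσ, p, h⟩ := exists_mul_insertCycle_eq hτ
    exact ⟨(σ, p), by simpa using hσ, h⟩

open Polynomial in
lemma X_mul_eq_sum_of_delta {m : ℕ} {D : ℚ[X][X]}
    (hD : (C X * X - X) * D = (An m).comp (C X * X) - An m) :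
    X * D = ∑ σ ∈ (finite_SnSet m).toFinset,
      (X : ℚ[X][X]) ^ desA m σ * C (X ^ majA m σ) * C (qnumQ (desA m σ)) := by
  have hq : (C X - 1 : ℚ[X][X]) ≠ 0 := by
    rw [← C_1, ← C_sub, Ne, C_eq_zero]
    simpa using X_sub_C_ne_zero (1 : ℚ)
  refine mul_left_cancel₀ hq ?_
  calc (C X - 1) * (X * D) = (C X * X - X) * D := by ring
    _ = _ := by
      rw [hD, An_eq_sum, Polynomial.sum_comp, ← Finset.sum_sub_distrib, Finset.mul_sum]
      refine Finset.sum_congr rfl fun σ _ => ?_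
      have hg : (C X - 1 : ℚ[X][X]) * C (qnumQ (desA m σ)) = C X ^ desA m σ - 1 := by
        rw [qnumQ, map_sum]
        simp only [C_pow]
        exact mul_geom_sum _ _
      rw [mul_left_comm, hg]
      simp only [mul_comp, pow_comp, X_comp, C_comp, mul_pow]
      ring

theorem stmt_2 (n : ℕ) (hn : 1 ≤ n) (D : Polynomial (Polynomial ℚ))
    (hD : (Polynomial.C Polynomial.X * Polynomial.X - Polynomial.X) * D =
      (An (n - 1)).comp (Polynomial.C Polynomial.X * Polynomial.X) - An (n - 1)) :
    An n =
      (1 + Polynomial.X * Polynomial.C Polynomial.X * Polynomial.C (qnumQ (n - 1))) * An (n - 1)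
        + Polynomial.X * Polynomial.C Polynomial.X * (1 - Polynomial.X) * D := by
  obtain ⟨m, rfl⟩ := Nat.exists_eq_add_of_le' hn
  rw [Nat.add_sub_cancel] at hD ⊢
  rw [show ∀ a b : Polynomial (Polynomial ℚ), Polynomial.X * a * b * D =
      a * b * (Polynomial.X * D) from fun a b => by ring,
    X_mul_eq_sum_of_delta hD, An_succ, An_eq_sum, Finset.mul_sum, Finset.mul_sum,
    ← Finset.sum_add_distrib]
  refine Finset.sum_congr rfl fun σ _ => ?_
  ring
end

section
/- Let n ≥ 1, σ ∈ T = {π ∈ B_n : des_A(π) = 0}, and u ∈ S_n ⊂ B_n. Then: maj_A(σu) = maj_A(u); inv(σu) = inv(u); des_A(σu) = des_A(u); neg(σu) = neg(σ); and Σ_{i ∈ Neg(σu)} (σu)(i) = Σ_{i ∈ Neg(σ)} σ(i). -/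
open Finset

theorem IsSignedPerm.apply_zero {n : ℕ} {π : Equiv.Perm ℤ} (h : IsSignedPerm n π) : π 0 = 0 := by
  have := h.1 0
  simp only [neg_zero] at this
  lia

theorem mem_Icc_apply_of_mem_SnSet {n : ℕ} {u : Equiv.Perm ℤ} (hu : u ∈ SnSet n) {a : ℤ}
    (ha : a ∈ Set.Icc 1 (n : ℤ)) : u a ∈ Set.Icc 1 (n : ℤ) := by
  obtain ⟨h1, hn⟩ := ha
  have hpos : 0 < u a := by
    have := hu.2 a.toNat (by rw [Finset.mem_Icc]; lia)
    rwa [Int.toNat_of_nonneg (by lia)] at this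
  refine ⟨hpos, ?_⟩
  by_contra! hlt
  have := u.injective (hu.1.2 (u a) (by rwa [abs_of_pos hpos]))
  lia

theorem mem_Icc_of_apply_mem_Icc {n : ℕ} {u : Equiv.Perm ℤ} (hu : u ∈ SnSet n) {a : ℤ}
    (ha : u a ∈ Set.Icc 1 (n : ℤ)) : a ∈ Set.Icc 1 (n : ℤ) := by
  obtain ⟨h1, hn⟩ := ha
  have hle : |a| ≤ n := by
    by_contra! h
    have := hu.1.2 a h
    have := abs_of_pos (show 0 < a by lia)
    lia
  rw [abs_le] at hle
  refine ⟨?_, hle.2⟩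
  by_contra! h
  rcases eq_or_lt_of_le (show a ≤ 0 by lia) with rfl | hneg
  · have := hu.1.apply_zero
    lia
  · have h2 := (mem_Icc_apply_of_mem_SnSet hu (a := -a) ⟨by lia, by lia⟩).1
    rw [hu.1.1] at h2
    lia

theorem strictMonoOn_of_mem_TSet {n : ℕ} {σ : Equiv.Perm ℤ} (hσ : σ ∈ TSet n) :
    StrictMonoOn σ (Set.Icc 1 (n : ℤ)) := by
  have hstep : ∀ a : ℤ, 1 ≤ a → a + 1 ≤ n → σ a < σ (a + 1) := by
    intro a h1 hn
    have hdes := Finset.filter_eq_empty_iff.mp (Finset.card_eq_zero.mp hσ.2)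
      (x := a.toNat) (by rw [Finset.mem_Icc]; lia)
    rw [Int.toNat_of_nonneg (by lia), not_lt] at hdes
    exact lt_of_le_of_ne hdes (σ.injective.ne (by lia))
  intro a ha b hb hab
  have key : ∀ c : ℤ, a + 1 ≤ c → c ≤ n → σ a < σ c := by
    intro c hc
    induction c, hc using Int.leInduction with
    | base => exact hstep a ha.1
    | succ c hc ih => exact fun h => (ih (by lia)).trans (hstep c (by have := ha.1; lia) h)
  exact key b hab hb.2

theorem mul_apply_lt_mul_apply_iff {n : ℕ} {σ u : Equiv.Perm ℤ} (hσ : σ ∈ TSet n)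
    (hu : u ∈ SnSet n) {a b : ℤ} (ha : a ∈ Set.Icc 1 (n : ℤ)) (hb : b ∈ Set.Icc 1 (n : ℤ)) :
    (σ * u) a < (σ * u) b ↔ u a < u b :=
  (strictMonoOn_of_mem_TSet hσ).lt_iff_lt (mem_Icc_apply_of_mem_SnSet hu ha)
    (mem_Icc_apply_of_mem_SnSet hu hb)

theorem DesA_mul {n : ℕ} {σ u : Equiv.Perm ℤ} (hσ : σ ∈ TSet n) (hu : u ∈ SnSet n) :
    DesA n (σ * u) = DesA n u := by
  refine Finset.filter_congr fun i hi => ?_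
  rw [Finset.mem_Icc] at hi
  exact mul_apply_lt_mul_apply_iff hσ hu ⟨by lia, by lia⟩ ⟨by lia, by lia⟩

theorem invStat_mul {n : ℕ} {σ u : Equiv.Perm ℤ} (hσ : σ ∈ TSet n) (hu : u ∈ SnSet n) :
    invStat n (σ * u) = invStat n u := by
  refine congrArg Finset.card (Finset.filter_congr fun p hp => ?_)
  simp only [Finset.mem_product, Finset.mem_Icc] at hp
  exact and_congr_right fun _ =>
    mul_apply_lt_mul_apply_iff hσ hu ⟨by lia, by lia⟩ ⟨by lia, by lia⟩

/-- Right multiplication by `u ∈ S_n` permutes the negative entries of a window. -/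
theorem sum_NegSet_mul {n : ℕ} {M : Type*} [AddCommMonoid M] (σ : Equiv.Perm ℤ)
    {u : Equiv.Perm ℤ} (hu : u ∈ SnSet n) (f : ℤ → M) :
    ∑ i ∈ NegSet n (σ * u), f ((σ * u) (i : ℤ)) = ∑ i ∈ NegSet n σ, f (σ (i : ℤ)) := by
  have hmem : ∀ i ∈ NegSet n (σ * u), u (i : ℤ) ∈ Set.Icc 1 (n : ℤ) := by
    intro i hi
    have := Finset.mem_Icc.mp (Finset.mem_filter.mp hi).1
    exact mem_Icc_apply_of_mem_SnSet hu ⟨by lia, by lia⟩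
  have hcast : ∀ i ∈ NegSet n (σ * u), ((u (i : ℤ)).toNat : ℤ) = u (i : ℤ) := fun i hi =>
    Int.toNat_of_nonneg (by have := (hmem i hi).1; lia)
  refine Finset.sum_bij (fun i _ => (u (i : ℤ)).toNat) (fun i hi => ?_) (fun i hi j hj hij => ?_)
    (fun j hj => ?_) (fun i hi => ?_)
  · obtain ⟨h1, h2⟩ := hmem i hi
    refine Finset.mem_filter.mpr ⟨Finset.mem_Icc.mpr ⟨by lia, by lia⟩, ?_⟩
    rw [hcast i hi]
    exact (Finset.mem_filter.mp hi).2
  · have : u (i : ℤ) = u (j : ℤ) := by rw [← hcast i hi, ← hcast j hj, hij]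
    exact_mod_cast u.injective this
  · obtain ⟨hj1, hj2⟩ := Finset.mem_filter.mp hj
    rw [Finset.mem_Icc] at hj1
    have hpre : u.symm (j : ℤ) ∈ Set.Icc 1 (n : ℤ) :=
      mem_Icc_of_apply_mem_Icc hu (by rw [u.apply_symm_apply]; exact ⟨by lia, by lia⟩)
    obtain ⟨h1, h2⟩ := hpre
    have hc : ((u.symm (j : ℤ)).toNat : ℤ) = u.symm (j : ℤ) := Int.toNat_of_nonneg (by lia)
    refine ⟨(u.symm (j : ℤ)).toNat,
      Finset.mem_filter.mpr ⟨Finset.mem_Icc.mpr ⟨by lia, by lia⟩, ?_⟩, ?_⟩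
    · rwa [hc, Equiv.Perm.mul_apply, u.apply_symm_apply]
    · rw [hc, u.apply_symm_apply, Int.toNat_natCast]
  · rw [hcast i hi, Equiv.Perm.mul_apply]

theorem stmt_5 (n : ℕ) (hn : 1 ≤ n) (σ u : Equiv.Perm ℤ)
    (hσ : σ ∈ TSet n) (hu : u ∈ SnSet n) :
    majA n (σ * u) = majA n u ∧
    invStat n (σ * u) = invStat n u ∧
    desA n (σ * u) = desA n u ∧
    negStat n (σ * u) = negStat n σ ∧
    (∑ i ∈ NegSet n (σ * u), (σ * u) (i : ℤ)) = ∑ i ∈ NegSet n σ, σ (i : ℤ) := by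
  refine ⟨?_, invStat_mul hσ hu, ?_, ?_, sum_NegSet_mul σ hu id⟩
  · rw [majA, majA, DesA_mul hσ hu]
  · rw [desA, desA, DesA_mul hσ hu]
  · rw [negStat, negStat, Finset.card_eq_sum_ones, Finset.card_eq_sum_ones]
    exact sum_NegSet_mul σ hu fun _ => 1
end

section
/- For every n ≥ 1, the negative major index nmaj is equidistributed with length over B_n: Σ_{π ∈ B_n} q^{nmaj(π)} = Σ_{π ∈ B_n} q^{ℓ(π)}. -/
open Finset

namespace MajInv

/-- The inversion number of the reversal of a word. -/
def revInv : List ℤ → ℕ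
  | [] => 0
  | x :: t => t.countP (x < ·) + revInv t

/-- The major index of the reversal of a word. -/
def revMaj : List ℤ → ℕ
  | [] => 0
  | x :: t => (if x < t.headI then t.length else 0) + revMaj t

/-- The word `π(n), …, π(1)`. -/
def revWindow (π : Equiv.Perm ℤ) : ℕ → List ℤ
  | 0 => []
  | n + 1 => π ((n + 1 : ℕ) : ℤ) :: revWindow π n

/-! ### Equidistribution on the arrangements of a finite set -/

/-- The words listing every element of `S` exactly once. -/
def arrangements (S : Finset ℤ) : Finset (List ℤ) := ⟨S.val.lists, Multiset.lists_nodup_finset S⟩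

theorem mem_arrangements {S : Finset ℤ} {l : List ℤ} : l ∈ arrangements S ↔ S.val = l :=
  Multiset.mem_lists_iff S.val l

theorem arrangements_empty : arrangements ∅ = {[]} := by
  ext l
  rw [mem_arrangements, Finset.empty_val]
  simp [eq_comm]

theorem sum_arrangements {M : Type*} [AddCommMonoid M] {S : Finset ℤ} (hS : S.Nonempty)
    (f : List ℤ → M) :
    ∑ l ∈ arrangements S, f l = ∑ x ∈ S, ∑ t ∈ arrangements (S.erase x), f (x :: t) := by
  rw [Finset.sum_sigma']
  symm
  refine Finset.sum_nbij (fun p : (_ : ℤ) × List ℤ => p.1 :: p.2) ?_ ?_ ?_ (fun _ _ => rfl)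
  · rintro ⟨x, t⟩ h
    simp only [Finset.mem_sigma, mem_arrangements] at h ⊢
    obtain ⟨hx, ht⟩ := h
    rw [Finset.erase_val] at ht
    have := Multiset.cons_erase (show x ∈ S.val from hx)
    rw [ht] at this
    rw [← this]
    rfl
  · rintro ⟨x, t⟩ _ ⟨y, u⟩ _ h
    simp only [List.cons.injEq] at h
    obtain ⟨rfl, rfl⟩ := h
    rfl
  · intro l hl
    simp only [Finset.mem_coe, mem_arrangements] at hl
    cases l with
    | nil =>
      obtain ⟨a, ha⟩ := hS
      rw [← Finset.mem_val, hl] at ha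
      simp at ha
    | cons x t =>
      have hl' : S.val = x ::ₘ (t : Multiset ℤ) := hl
      refine ⟨⟨x, t⟩, ?_, rfl⟩
      simp only [Finset.mem_coe, Finset.mem_sigma, mem_arrangements, Finset.erase_val]
      refine ⟨?_, ?_⟩
      · rw [← Finset.mem_val, hl']
        simp
      · rw [hl', Multiset.erase_cons_head]

theorem sum_rank {M : Type*} [AddCommMonoid M] (S : Finset ℤ) (g : ℕ → M) :
    ∑ y ∈ S, g #{z ∈ S | y < z} = ∑ i ∈ range #S, g i := by
  induction S using Finset.induction_on_min with
  | empty => simp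
  | insert a s ha ih =>
    have hn : a ∉ s := fun h => lt_irrefl _ (ha a h)
    rw [Finset.sum_insert hn, Finset.card_insert_of_notMem hn, Finset.sum_range_succ, ← ih,
      add_comm]
    congr 1
    · refine Finset.sum_congr rfl fun y hy => ?_
      rw [Finset.filter_insert, if_neg (ha y hy).not_gt]
    · rw [Finset.filter_insert, if_neg (lt_irrefl a), Finset.filter_true_of_mem ha]

theorem lt_iff_rank_lt {S : Finset ℤ} {x y : ℤ} (hy : y ∈ S) :
    x < y ↔ #{z ∈ S | y < z} < #{z ∈ S | x < z} := by
  constructor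
  · intro h
    apply Finset.card_lt_card
    rw [Finset.ssubset_iff_of_subset]
    · exact ⟨y, by simp [hy, h], by simp⟩
    · intro z
      simp only [Finset.mem_filter]
      exact fun hz => ⟨hz.1, h.trans hz.2⟩
  · intro h
    by_contra hxy
    refine absurd h (not_lt.2 (Finset.card_le_card fun z => ?_))
    simp only [Finset.mem_filter]
    exact fun hz => ⟨hz.1, lt_of_le_of_lt (not_lt.1 hxy) hz.2⟩

variable {R : Type*} [CommSemiring R]

theorem sum_shifted_rank (q : R) (S : Finset ℤ) (x : ℤ) :
    ∑ y ∈ S, q ^ ((if x < y then #S else 0) + #{z ∈ S | y < z}) =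
      q ^ #{z ∈ S | x < z} * ∑ i ∈ range #S, q ^ i := by
  have hc : #{z ∈ S | x < z} ≤ #S := Finset.card_filter_le _ _
  rw [Finset.sum_congr rfl (g := fun y =>
    (fun i => q ^ ((if i < #{z ∈ S | x < z} then #S else 0) + i)) #{z ∈ S | y < z})
    fun y hy => by simp only [lt_iff_rank_lt hy]]
  rw [sum_rank S fun i => q ^ ((if i < #{z ∈ S | x < z} then #S else 0) + i)]
  generalize #{z ∈ S | x < z} = c at *
  generalize #S = m at *
  obtain ⟨d, rfl⟩ := Nat.exists_eq_add_of_le hc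
  rw [Finset.sum_range_add, add_comm c d, Finset.sum_range_add, mul_add, add_comm,
    Finset.mul_sum, Finset.mul_sum]
  congr 1
  · refine Finset.sum_congr rfl fun i _ => ?_
    rw [if_neg (by omega), ← pow_add]
    congr 1
    omega
  · refine Finset.sum_congr rfl fun i hi => ?_
    rw [if_pos (Finset.mem_range.1 hi), ← pow_add]
    congr 1
    omega

theorem countP_of_mem_arrangements {S : Finset ℤ} {t : List ℤ} (ht : t ∈ arrangements S) (x : ℤ) :
    t.countP (x < ·) = #{z ∈ S | x < z} := by
  rw [mem_arrangements] at ht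
  rw [Finset.card_def, Finset.filter_val, ht, ← Multiset.countP_eq_card_filter]
  exact (Multiset.coe_countP (x < ·) t).symm

theorem sum_pow_revInv_cons (q : R) (S : Finset ℤ) (x : ℤ) :
    ∑ t ∈ arrangements S, q ^ revInv (x :: t) =
      q ^ #{z ∈ S | x < z} * ∑ t ∈ arrangements S, q ^ revInv t := by
  rw [Finset.mul_sum]
  refine Finset.sum_congr rfl fun t ht => ?_
  rw [revInv, countP_of_mem_arrangements ht, pow_add]

/-- The `q`-factorial. -/
def qFactorial (q : R) (n : ℕ) : R := ∏ k ∈ range n, ∑ i ∈ range (k + 1), q ^ i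

theorem sum_pow_revInv (q : R) (n : ℕ) {S : Finset ℤ} (hS : #S = n) :
    ∑ t ∈ arrangements S, q ^ revInv t = qFactorial q n := by
  induction n generalizing S with
  | zero =>
    obtain rfl := Finset.card_eq_zero.1 hS
    simp [arrangements_empty, qFactorial, revInv]
  | succ n ih =>
    rw [sum_arrangements (Finset.card_pos.1 (by omega)), qFactorial, Finset.prod_range_succ,
      ← qFactorial, ← hS, ← sum_rank S, Finset.mul_sum]
    refine Finset.sum_congr rfl fun y hy => ?_
    rw [sum_pow_revInv_cons, ih (by rw [Finset.card_erase_of_mem hy, hS]; rfl), mul_comm,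
      Finset.filter_erase, Finset.erase_eq_of_notMem (by simp)]

theorem sum_pow_revMaj_cons (q : R) (n : ℕ) {S : Finset ℤ} (hS : #S = n) (x : ℤ) :
    ∑ t ∈ arrangements S, q ^ revMaj (x :: t) = ∑ t ∈ arrangements S, q ^ revInv (x :: t) := by
  induction n generalizing S x with
  | zero =>
    obtain rfl := Finset.card_eq_zero.1 hS
    simp [arrangements_empty, revMaj, revInv, -List.headI_nil]
  | succ n ih =>
    rw [sum_pow_revInv_cons, sum_pow_revInv q _ hS, qFactorial, Finset.prod_range_succ,
      ← qFactorial, mul_left_comm, ← hS, ← sum_shifted_rank q S x, Finset.mul_sum,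
      sum_arrangements (Finset.card_pos.1 (by omega))]
    refine Finset.sum_congr rfl fun y hy => ?_
    have hc : #(S.erase y) = n := by rw [Finset.card_erase_of_mem hy, hS]; rfl
    have hr : #{z ∈ S.erase y | y < z} = #{z ∈ S | y < z} := by
      rw [Finset.filter_erase, Finset.erase_eq_of_notMem (by simp)]
    have key := ih hc y
    rw [sum_pow_revInv_cons, sum_pow_revInv q _ hc, hr] at key
    rw [pow_add, mul_left_comm, mul_comm (qFactorial q n), ← key, Finset.mul_sum]
    refine Finset.sum_congr rfl fun t ht => ?_
    have hl : t.length = n := by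
      rw [mem_arrangements] at ht
      rw [← hc, Finset.card_def, ht]
      rfl
    rw [revMaj, pow_add, List.headI_cons, List.length_cons, hl, hS]

theorem sum_pow_revMaj (q : R) (S : Finset ℤ) :
    ∑ t ∈ arrangements S, q ^ revMaj t = ∑ t ∈ arrangements S, q ^ revInv t := by
  obtain rfl | hS := S.eq_empty_or_nonempty
  · simp [arrangements_empty, revMaj, revInv]
  · rw [sum_arrangements hS, sum_arrangements hS]
    exact Finset.sum_congr rfl fun x _ => sum_pow_revMaj_cons q _ rfl x

/-! ### Statistics of a signed permutation in terms of its window -/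

theorem length_revWindow (π : Equiv.Perm ℤ) (n : ℕ) : (revWindow π n).length = n := by
  induction n with
  | zero => rfl
  | succ n ih => simp [revWindow, ih]

theorem mem_revWindow {π : Equiv.Perm ℤ} {n : ℕ} {x : ℤ} :
    x ∈ revWindow π n ↔ ∃ i : ℕ, 1 ≤ i ∧ i ≤ n ∧ π i = x := by
  induction n with
  | zero =>
    simp only [revWindow, List.not_mem_nil, false_iff]
    rintro ⟨i, h1, h2, -⟩
    omega
  | succ n ih =>
    rw [revWindow, List.mem_cons, ih]
    constructor
    · rintro (rfl | ⟨i, h1, h2, rfl⟩)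
      · exact ⟨n + 1, by omega, le_rfl, rfl⟩
      · exact ⟨i, h1, by omega, rfl⟩
    · rintro ⟨i, h1, h2, rfl⟩
      obtain rfl | h := Nat.eq_or_lt_of_le h2
      · exact Or.inl rfl
      · exact Or.inr ⟨i, h1, by omega, rfl⟩

theorem revMaj_revWindow (π : Equiv.Perm ℤ) (n : ℕ) : revMaj (revWindow π n) = majA n π := by
  induction n with
  | zero => simp [revWindow, revMaj, majA, DesA]
  | succ n ih =>
    rw [revWindow, revMaj, ih, length_revWindow]
    cases n with
    | zero => simp [majA, DesA]
    | succ m =>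
      simp only [majA, DesA, Finset.sum_filter, Nat.add_sub_cancel, revWindow, List.headI_cons]
      rw [Finset.sum_Icc_succ_top (by omega : 1 ≤ m + 1), add_comm]
      push_cast
      rfl

theorem countP_revWindow (π : Equiv.Perm ℤ) (n : ℕ) (x : ℤ) :
    (revWindow π n).countP (x < ·) = ∑ i ∈ Icc 1 n, if x < π (i : ℤ) then 1 else 0 := by
  induction n with
  | zero => simp [revWindow]
  | succ n ih =>
    rw [revWindow, List.countP_cons, ih, Finset.sum_Icc_succ_top (by omega)]
    simp

theorem revInv_revWindow (π : Equiv.Perm ℤ) (n : ℕ) : revInv (revWindow π n) = invStat n π := by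
  induction n with
  | zero => simp [revWindow, revInv, invStat]
  | succ n ih =>
    rw [revWindow, revInv, ih, countP_revWindow]
    simp only [invStat, Finset.card_filter, Finset.sum_product]
    simp only [Finset.sum_Icc_succ_top (show 1 ≤ n + 1 by omega), lt_irrefl, false_and, if_false,
      add_zero, Finset.sum_add_distrib]
    have h1 : ∑ j ∈ Icc 1 n,
        (if n + 1 < j ∧ π (j : ℤ) < π ((n + 1 : ℕ) : ℤ) then 1 else 0) = 0 :=
      Finset.sum_eq_zero fun j hj => if_neg (by rw [Finset.mem_Icc] at hj; omega)
    have h2 : ∑ i ∈ Icc 1 n, (if i < n + 1 ∧ π ((n + 1 : ℕ) : ℤ) < π (i : ℤ) then 1 else 0) =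
        ∑ i ∈ Icc 1 n, if π ((n + 1 : ℕ) : ℤ) < π (i : ℤ) then 1 else 0 :=
      Finset.sum_congr rfl fun i hi => by
        rw [Finset.mem_Icc] at hi
        simp [show i < n + 1 by omega]
    rw [h1, h2, add_zero, add_comm]

theorem negSum_eq (π : Equiv.Perm ℤ) (n : ℕ) :
    negSum n π =
      ((revWindow π n : Multiset ℤ).map fun x => if x < 0 then x.natAbs else 0).sum := by
  simp only [negSum, NegSet, Finset.sum_filter, Multiset.map_coe, Multiset.sum_coe]
  induction n with
  | zero => simp [revWindow]
  | succ n ih =>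
    rw [Finset.sum_Icc_succ_top (by omega), ih, revWindow, List.map_cons, List.sum_cons, add_comm]

theorem nodup_revWindow (π : Equiv.Perm ℤ) (n : ℕ) : (revWindow π n).Nodup := by
  induction n with
  | zero => exact List.nodup_nil
  | succ n ih =>
    refine List.nodup_cons.2 ⟨fun h => ?_, ih⟩
    obtain ⟨i, -, hi, h⟩ := mem_revWindow.1 h
    have := π.injective h
    omega

theorem apply_eq_of_revWindow_eq {π ρ : Equiv.Perm ℤ} {n : ℕ}
    (h : revWindow π n = revWindow ρ n) {i : ℕ} (h1 : 1 ≤ i) (hi : i ≤ n) :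
    π (i : ℤ) = ρ (i : ℤ) := by
  induction n with
  | zero => omega
  | succ n ih =>
    simp only [revWindow, List.cons.injEq] at h
    obtain rfl | hi := Nat.eq_or_lt_of_le hi
    · exact h.1
    · exact ih h.2 (by omega)

theorem revWindow_eq_of_apply_eq {π : Equiv.Perm ℤ} (l : List ℤ)
    (h : ∀ i (hi : i < l.length), π ((i + 1 : ℕ) : ℤ) = l.reverse[i]'(by simpa)) :
    revWindow π l.length = l := by
  induction l with
  | nil => rfl
  | cons x t ih =>
    rw [List.length_cons, revWindow]
    congr 1
    · rw [h t.length (by simp)]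
      simp
    · refine ih fun i hi => ?_
      rw [h i (by simp; omega)]
      simp [hi]

theorem apply_zero_of_isSignedPerm {n : ℕ} {π : Equiv.Perm ℤ} (h : IsSignedPerm n π) : π 0 = 0 := by
  have := h.1 0
  rw [neg_zero] at this
  omega

theorem injOn_revWindow (n : ℕ) : Set.InjOn (fun π => revWindow π n) (BSet n) := by
  intro π hπ ρ hρ h
  ext a
  by_cases ha : (n : ℤ) < |a|
  · rw [hπ.2 a ha, hρ.2 a ha]
  · have hpos : ∀ i : ℕ, i ≤ n → π (i : ℤ) = ρ (i : ℤ) := by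
      intro i hi
      obtain rfl | h0 := Nat.eq_zero_or_pos i
      · rw [Nat.cast_zero, apply_zero_of_isSignedPerm hπ, apply_zero_of_isSignedPerm hρ]
      · exact apply_eq_of_revWindow_eq h h0 hi
    obtain ⟨i, rfl | rfl⟩ := Int.eq_nat_or_neg a
    · exact hpos i (by simpa using ha)
    · rw [hπ.1, hρ.1, hpos i (by simpa using ha)]

/-- A word whose absolute values are distinct and lie in `[1, n]` is the window of a signed
permutation. -/
theorem exists_signedPerm {n : ℕ} {l : List ℤ} (hl : l.length = n)
    (hnd : (l.map Int.natAbs).Nodup) (hpos : ∀ x ∈ l, x ≠ 0) (hle : ∀ x ∈ l, |x| ≤ n) :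
    ∃ π, IsSignedPerm n π ∧ revWindow π n = l := by
  obtain ⟨g, hg⟩ : ∃ g : ℕ → ℤ, ∀ i (hi : i < l.length), g (i + 1) = l.reverse[i]'(by simpa) :=
    ⟨fun i => l.reverse.getD (i - 1) 0, fun i hi => by simp [hi]⟩
  have hmem : ∀ i, 1 ≤ i → i ≤ n → g i ∈ l := by
    intro i h1 hi
    obtain ⟨k, rfl⟩ := Nat.exists_eq_add_of_le' h1
    rw [hg k (by omega)]
    exact List.mem_reverse.1 (List.getElem_mem _)
  have hinj : ∀ i j, 1 ≤ i → i ≤ n → 1 ≤ j → j ≤ n → (g i).natAbs = (g j).natAbs → i = j := by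
    intro i j h1 hi h1' hj h
    obtain ⟨k, rfl⟩ := Nat.exists_eq_add_of_le' h1
    obtain ⟨m, rfl⟩ := Nat.exists_eq_add_of_le' h1'
    rw [hg k (by omega), hg m (by omega)] at h
    have hnd' : (l.reverse.map Int.natAbs).Nodup := by
      rw [List.map_reverse]
      exact List.nodup_reverse.2 hnd
    have := (hnd'.getElem_inj_iff (i := k) (j := m) (hi := by simp; omega)
      (hj := by simp; omega)).1 (by simpa using h)
    omega
  let f : ℤ → ℤ := fun a => if (n : ℤ) < |a| then a else a.sign * g a.natAbs
  have hin : ∀ a, (n : ℤ) < |a| → f a = a := fun a h => if_pos h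
  have hout : ∀ a, ¬(n : ℤ) < |a| → f a = a.sign * g a.natAbs := fun a h => if_neg h
  have hodd : ∀ a, f (-a) = -f a := by
    intro a
    by_cases h : (n : ℤ) < |a|
    · rw [hin a h, hin (-a) (by rwa [abs_neg])]
    · rw [hout a h, hout (-a) (by rwa [abs_neg]), Int.sign_neg, Int.natAbs_neg, neg_mul]
  have hzero : f 0 = 0 := by
    rw [hout 0 (by simp)]
    simp
  have hnat : ∀ i : ℕ, 1 ≤ i → i ≤ n → f i = g i := by
    intro i h1 hi
    rw [hout i (by rw [Nat.abs_cast]; omega), Int.sign_eq_one_of_pos (by omega)]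
    simp
  have hnz : ∀ i : ℕ, 1 ≤ i → i ≤ n → f i ≠ 0 := fun i h1 hi => by
    rw [hnat i h1 hi]
    exact hpos _ (hmem i h1 hi)
  have hmaps : ∀ a : ℤ, |a| ≤ n → |f a| ≤ n := by
    intro a ha
    obtain ⟨i, hi⟩ := Int.eq_nat_or_neg a
    have hi' : |f a| = |f i| := by
      obtain rfl | rfl := hi
      · rfl
      · rw [hodd, abs_neg]
    have hin' : i ≤ n := by
      obtain rfl | rfl := hi <;> simpa using ha
    rw [hi']
    obtain rfl | h0 := Nat.eq_zero_or_pos i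
    · simp [hzero]
    · rw [hnat i h0 hin']
      exact hle _ (hmem i h0 hin')
  have hinj0 : ∀ i j : ℕ, i ≤ n → j ≤ n → (f i).natAbs = (f j).natAbs → i = j := by
    intro i j hi hj h
    obtain rfl | hi0 := Nat.eq_zero_or_pos i
    · obtain rfl | hj0 := Nat.eq_zero_or_pos j
      · rfl
      · rw [Nat.cast_zero, hzero, Int.natAbs_zero, eq_comm, Int.natAbs_eq_zero] at h
        exact absurd h (hnz j hj0 hj)
    · obtain rfl | hj0 := Nat.eq_zero_or_pos j
      · rw [Nat.cast_zero, hzero, Int.natAbs_zero, Int.natAbs_eq_zero] at h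
        exact absurd h (hnz i hi0 hi)
      · rw [hnat i hi0 hi, hnat j hj0 hj] at h
        exact hinj i j hi0 hi hj0 hj h
  have hinjOn : Set.InjOn f (Finset.Icc (-n : ℤ) n) := by
    intro a ha b hb h
    simp only [Finset.coe_Icc, Set.mem_Icc] at ha hb
    have habs : ∀ c : ℤ, (f c).natAbs = (f (c.natAbs : ℤ)).natAbs := by
      intro c
      obtain ⟨i, rfl | rfl⟩ := Int.eq_nat_or_neg c
      · simp
      · rw [hodd, Int.natAbs_neg, Int.natAbs_neg, Int.natAbs_natCast]
    have hab : a.natAbs = b.natAbs := by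
      refine hinj0 _ _ (by omega) (by omega) ?_
      rw [← habs, ← habs, h]
    obtain rfl | rfl := Int.natAbs_eq_natAbs_iff.1 hab
    · rfl
    · obtain ⟨i, hi⟩ := Int.eq_nat_or_neg b
      obtain rfl | h0 := Nat.eq_zero_or_pos i
      · obtain rfl | rfl := hi <;> simp
      · have hne := hnz i h0 (by omega)
        rw [hodd] at h
        obtain rfl | rfl := hi
        · omega
        · rw [hodd] at h
          omega
  have hmapsTo : Set.MapsTo f (Finset.Icc (-n : ℤ) n) (Finset.Icc (-n : ℤ) n) := by
    intro a ha
    simp only [Finset.coe_Icc, Set.mem_Icc, ← abs_le] at ha ⊢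
    exact hmaps a ha
  have hsurjOn : Set.SurjOn f (Finset.Icc (-n : ℤ) n) (Finset.Icc (-n : ℤ) n) :=
    Finset.surjOn_of_injOn_of_card_le f hmapsTo hinjOn le_rfl
  have hbij : Function.Bijective f := by
    constructor
    · intro a b h
      by_cases ha : (n : ℤ) < |a| <;> by_cases hb : (n : ℤ) < |b|
      · rwa [hin a ha, hin b hb] at h
      · have := hmaps b (not_lt.1 hb)
        rw [← h, hin a ha] at this
        exact absurd ha (not_lt.2 this)
      · have := hmaps a (not_lt.1 ha)
        rw [h, hin b hb] at this
        exact absurd hb (not_lt.2 this)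
      · exact hinjOn (by simpa [← abs_le] using ha) (by simpa [← abs_le] using hb) h
    · intro b
      by_cases hb : (n : ℤ) < |b|
      · exact ⟨b, hin b hb⟩
      · obtain ⟨a, -, h⟩ := hsurjOn (show b ∈ _ by simpa [← abs_le] using hb)
        exact ⟨a, h⟩
  refine ⟨Equiv.ofBijective f hbij, ⟨hodd, hin⟩, ?_⟩
  subst hl
  refine revWindow_eq_of_apply_eq l fun i hi => ?_
  rw [← hg i hi]
  exact hnat (i + 1) (by omega) (by omega)

theorem exists_signedPerm_of_perm {n : ℕ} {π : Equiv.Perm ℤ} (hπ : IsSignedPerm n π) {l : List ℤ}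
    (hl : l.Perm (revWindow π n)) : ∃ ρ, IsSignedPerm n ρ ∧ revWindow ρ n = l := by
  have hne : ∀ i : ℕ, 1 ≤ i → π i ≠ 0 := by
    intro i hi h
    rw [← apply_zero_of_isSignedPerm hπ] at h
    have := π.injective h
    omega
  refine exists_signedPerm (hl.length_eq.trans (length_revWindow π n)) ?_ ?_ ?_
  · rw [(hl.map Int.natAbs).nodup_iff]
    refine List.Nodup.map_on ?_ (nodup_revWindow π n)
    intro x hx y hy h
    obtain ⟨i, hi, -, rfl⟩ := mem_revWindow.1 hx
    obtain ⟨j, hj, -, rfl⟩ := mem_revWindow.1 hy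
    obtain h | h := Int.natAbs_eq_natAbs_iff.1 h
    · exact h
    · rw [← hπ.1] at h
      have := π.injective h
      omega
  · intro x hx
    obtain ⟨i, hi, -, rfl⟩ := mem_revWindow.1 (hl.mem_iff.1 hx)
    exact hne i hi
  · intro x hx
    obtain ⟨i, hi, hin, rfl⟩ := mem_revWindow.1 (hl.mem_iff.1 hx)
    by_contra h
    have := π.injective (hπ.2 _ (not_le.1 h))
    rw [this, Nat.abs_cast] at h
    omega

/-- A word statistic summed over the signed permutations with a prescribed set of window values. -/
theorem sum_filter_revWindow {M : Type*} [AddCommMonoid M] {n : ℕ} {B : Finset (Equiv.Perm ℤ)}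
    (hB : ∀ π, π ∈ B ↔ IsSignedPerm n π) {π : Equiv.Perm ℤ} (hπ : π ∈ B) (f : List ℤ → M) :
    ∑ ρ ∈ B with (revWindow ρ n : Multiset ℤ) = revWindow π n, f (revWindow ρ n) =
      ∑ l ∈ arrangements ⟨revWindow π n, nodup_revWindow π n⟩, f l := by
  refine Finset.sum_nbij (fun ρ => revWindow ρ n) ?_ ?_ ?_ (fun _ _ => rfl)
  · intro ρ hρ
    rw [mem_arrangements]
    exact (Finset.mem_filter.1 hρ).2.symm
  · exact (injOn_revWindow n).mono fun ρ hρ => (hB ρ).1 (Finset.mem_filter.1 hρ).1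
  · intro l hl
    rw [Finset.mem_coe, mem_arrangements] at hl
    obtain ⟨ρ, hρ, rfl⟩ := exists_signedPerm_of_perm ((hB π).1 hπ) (Multiset.coe_eq_coe.1 hl).symm
    exact ⟨ρ, by simpa [hB, hρ] using hl.symm, rfl⟩

theorem sum_pow_nmaj (q : R) {n : ℕ} {B : Finset (Equiv.Perm ℤ)}
    (hB : ∀ π, π ∈ B ↔ IsSignedPerm n π) : ∑ π ∈ B, q ^ nmaj n π = ∑ π ∈ B, q ^ lenB n π := by
  have hmaps : ∀ π ∈ B, (revWindow π n : Multiset ℤ) ∈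
      B.image fun π => (revWindow π n : Multiset ℤ) := fun π => Finset.mem_image_of_mem _
  rw [← Finset.sum_fiberwise_of_maps_to hmaps, ← Finset.sum_fiberwise_of_maps_to hmaps]
  refine Finset.sum_congr rfl fun s hs => ?_
  obtain ⟨π, hπ, rfl⟩ := Finset.mem_image.1 hs
  have hfactor : ∀ (st : Equiv.Perm ℤ → ℕ) (f : List ℤ → ℕ), (∀ ρ, f (revWindow ρ n) = st ρ) →
      ∑ ρ ∈ B with (revWindow ρ n : Multiset ℤ) = revWindow π n, q ^ (st ρ + negSum n ρ) =
        (∑ l ∈ arrangements ⟨revWindow π n, nodup_revWindow π n⟩, q ^ f l) * q ^ negSum n π := by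
    intro st f hst
    rw [← sum_filter_revWindow hB hπ fun l => q ^ f l, Finset.sum_mul]
    refine Finset.sum_congr rfl fun ρ hρ => ?_
    rw [pow_add, hst, negSum_eq ρ, negSum_eq π, (Finset.mem_filter.1 hρ).2]
  simp only [nmaj, lenB]
  rw [hfactor _ revMaj fun ρ => revMaj_revWindow ρ n,
    hfactor _ revInv fun ρ => revInv_revWindow ρ n]
  congr 1
  exact sum_pow_revMaj q ⟨revWindow π n, nodup_revWindow π n⟩

end MajInv

theorem stmt_7 (n : ℕ) (hn : 1 ≤ n) :
    (∑ᶠ π ∈ BSet n, (Polynomial.X : Polynomial ℤ) ^ nmaj n π) =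
    ∑ᶠ π ∈ BSet n, (Polynomial.X : Polynomial ℤ) ^ lenB n π := by
  by_cases hfin : (BSet n).Finite
  · rw [finsum_mem_eq_finite_toFinset_sum _ hfin, finsum_mem_eq_finite_toFinset_sum _ hfin]
    exact MajInv.sum_pow_nmaj _ fun π => hfin.mem_toFinset
  · have hsupp : ∀ st : Equiv.Perm ℤ → ℕ,
        (BSet n ∩ Function.support fun π => (Polynomial.X : Polynomial ℤ) ^ st π).Infinite := by
      intro st
      rwa [Set.inter_eq_left.2 fun π _ =>
        Function.mem_support.2 (pow_ne_zero (st π) Polynomial.X_ne_zero)]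
    rw [finsum_mem_eq_zero_of_infinite (hsupp _), finsum_mem_eq_zero_of_infinite (hsupp _)]
end

section
/- For every n ≥ 1, Σ_{π ∈ B_n} t^{ndes(π)} q^{nmaj(π)} = ∏_{i=1}^{n} (1 + t q^i) · Σ_{u ∈ S_n} t^{des(u)} q^{maj(u)}. -/
open Finset

namespace IsSignedPerm

variable {n : ℕ} {π σ : Equiv.Perm ℤ}

theorem mul (hπ : IsSignedPerm n π) (hσ : IsSignedPerm n σ) : IsSignedPerm n (π * σ) := by
  refine ⟨fun a => ?_, fun a ha => ?_⟩
  · simp only [Equiv.Perm.mul_apply, hσ.1, hπ.1]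
  · simp only [Equiv.Perm.mul_apply, hσ.2 a ha, hπ.2 a ha]

theorem inv (hπ : IsSignedPerm n π) : IsSignedPerm n π⁻¹ := by
  refine ⟨fun a => ?_, fun a ha => ?_⟩
  · rw [Equiv.Perm.inv_eq_iff_eq, hπ.1, Equiv.Perm.inv_def, Equiv.apply_symm_apply]
  · rw [Equiv.Perm.inv_eq_iff_eq, hπ.2 a ha]

theorem map_zero (hπ : IsSignedPerm n π) : π 0 = 0 := by
  have := hπ.1 0
  rw [neg_zero] at this
  omega

theorem map_ne_zero (hπ : IsSignedPerm n π) {a : ℤ} (ha : a ≠ 0) : π a ≠ 0 := fun h =>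
  ha (π.injective (h.trans hπ.map_zero.symm))

theorem abs_map_le (hπ : IsSignedPerm n π) {a : ℤ} (ha : |a| ≤ n) : |π a| ≤ n := by
  by_contra! h
  rw [π.injective (hπ.2 _ h)] at h
  omega

end IsSignedPerm

theorem finite_BSet (n : ℕ) : (BSet n).Finite := by
  classical
  have : Finite {f : Equiv.Perm ℤ // ∀ a, ¬ a ∈ Finset.Icc (-(n : ℤ)) n → f a = a} :=
    Finite.of_equiv _ (Equiv.Perm.subtypeEquivSubtypePerm (· ∈ Finset.Icc (-(n : ℤ)) n))
  refine Set.Finite.subset (s := {f : Equiv.Perm ℤ | ∀ a, ¬ a ∈ Finset.Icc (-(n : ℤ)) n → f a = a})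
    this fun π hπ a ha => hπ.2 a ?_
  by_contra! h
  exact ha (Finset.mem_Icc.2 (abs_le.1 h))

theorem SnSet_subset_BSet (n : ℕ) : SnSet n ⊆ BSet n := fun _ h => h.1

theorem mem_SnSet_iff {n : ℕ} {u : Equiv.Perm ℤ} :
    u ∈ SnSet n ↔ IsSignedPerm n u ∧ ∀ a : ℤ, 0 < a → 0 < u a := by
  refine and_congr_right fun hu => ⟨fun h a ha => ?_, fun h i hi => h i ?_⟩
  · rcases le_or_gt a n with han | han
    · lift a to ℕ using ha.le
      exact h a (Finset.mem_Icc.2 (by omega))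
    · rwa [hu.2 a (han.trans_le (le_abs_self a))]
  · have := Finset.mem_Icc.1 hi
    omega

theorem map_pos_iff_of_mem_SnSet {n : ℕ} {u : Equiv.Perm ℤ} (hu : u ∈ SnSet n) {a : ℤ} :
    0 < u a ↔ 0 < a := by
  obtain ⟨hs, hpos⟩ := mem_SnSet_iff.1 hu
  refine ⟨fun h => ?_, hpos a⟩
  by_contra! ha
  rcases ha.lt_or_eq with ha | rfl
  · have := hpos (-a) (by omega)
    rw [hs.1] at this
    omega
  · rw [hs.map_zero] at h
    omega

theorem mul_mem_SnSet {n : ℕ} {u v : Equiv.Perm ℤ} (hu : u ∈ SnSet n) (hv : v ∈ SnSet n) :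
    u * v ∈ SnSet n :=
  mem_SnSet_iff.2 ⟨hu.1.mul hv.1, fun a ha => by
    rwa [Equiv.Perm.mul_apply, map_pos_iff_of_mem_SnSet hu, map_pos_iff_of_mem_SnSet hv]⟩

theorem inv_mem_SnSet {n : ℕ} {u : Equiv.Perm ℤ} (hu : u ∈ SnSet n) : u⁻¹ ∈ SnSet n :=
  mem_SnSet_iff.2 ⟨hu.1.inv, fun a ha => by
    rwa [← map_pos_iff_of_mem_SnSet hu, Equiv.Perm.inv_def, Equiv.apply_symm_apply]⟩

theorem map_mem_Icc_of_mem_SnSet {n : ℕ} {u : Equiv.Perm ℤ} (hu : u ∈ SnSet n) {a : ℤ}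
    (ha : a ∈ Set.Icc (1 : ℤ) n) : u a ∈ Set.Icc (1 : ℤ) n := by
  have h1 : 0 < u a := (map_pos_iff_of_mem_SnSet hu).2 (by have := ha.1; omega)
  have h2 := hu.1.abs_map_le (a := a) (by rw [abs_of_pos (by have := ha.1; omega)]; exact ha.2)
  exact ⟨h1, (le_abs_self _).trans h2⟩

/-- The odd extension to `ℤ` of a permutation of `ℤ` preserving positivity. -/
def oddExtension (p : Equiv.Perm ℤ) (hp : ∀ a, 0 < p a ↔ 0 < a) : Equiv.Perm ℤ where
  toFun a := if 0 < a then p a else if a < 0 then - p (-a) else 0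
  invFun a := if 0 < a then p.symm a else if a < 0 then - p.symm (-a) else 0
  left_inv a := by
    rcases lt_trichotomy a 0 with ha | rfl | ha
    · have := (hp (-a)).2 (by omega)
      simp [ha, ha.not_gt, this, this.not_gt]
    · simp
    · have := (hp a).2 ha
      simp [ha, this]
  right_inv a := by
    rcases lt_trichotomy a 0 with ha | rfl | ha
    · have := (hp (p.symm (-a))).1 (by rw [p.apply_symm_apply]; omega)
      simp [ha, ha.not_gt, this, this.not_gt]
    · simp
    · have := (hp (p.symm a)).1 (by rwa [p.apply_symm_apply])
      simp [ha, this]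

theorem oddExtension_mem_SnSet {n : ℕ} (p : Equiv.Perm ℤ) (hp : ∀ a, 0 < p a ↔ 0 < a)
    (hn : ∀ a : ℤ, n < a → p a = a) : oddExtension p hp ∈ SnSet n := by
  refine mem_SnSet_iff.2 ⟨⟨fun a => ?_, fun a ha => ?_⟩, fun a ha => ?_⟩
  · rcases lt_trichotomy a 0 with ha | rfl | ha
    · simp [oddExtension, ha, ha.not_gt]
    · simp [oddExtension]
    · simp [oddExtension, ha, ha.not_gt]
  · rcases lt_trichotomy a 0 with h | rfl | h
    · rw [abs_of_neg h] at ha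
      simp [oddExtension, h, h.not_gt, hn _ ha]
    · simp [oddExtension]
    · rw [abs_of_pos h] at ha
      simp [oddExtension, h, hn _ ha]
  · simpa [oddExtension, ha] using (hp a).2 ha

/-- The bijection `i ↦ i + 1` from `Fin n` to the integer interval `[1, n]`. -/
def finEquivIcc (n : ℕ) : Fin n ≃ {a : ℤ // 1 ≤ a ∧ a ≤ n} where
  toFun i := ⟨i + 1, by omega⟩
  invFun a := ⟨(a.1 - 1).toNat, by have := a.2; omega⟩
  left_inv i := by ext; simp
  right_inv a := by
    have := a.2
    ext
    simp only
    omega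

/-- Any window can be sorted by precomposing with an element of `S_n`. -/
theorem exists_mem_SnSet_strictMonoOn (n : ℕ) (τ : Equiv.Perm ℤ) :
    ∃ r ∈ SnSet n, StrictMonoOn (τ * r) (Set.Icc (1 : ℤ) n) := by
  let e := finEquivIcc n
  let ρ := Tuple.sort fun i => τ (e i)
  have hmono : Monotone fun i => τ (e (ρ i)) := Tuple.monotone_sort fun i => τ (e i)
  let p := ρ.extendDomain e
  have hout : ∀ a : ℤ, ¬ (1 ≤ a ∧ a ≤ n) → p a = a := fun a ha =>
    ρ.extendDomain_apply_not_subtype e ha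
  have hin : ∀ i, p (e i) = e (ρ i) := fun i => ρ.extendDomain_apply_image e i
  have hp : ∀ a, 0 < p a ↔ 0 < a := fun a => by
    by_cases ha : 1 ≤ a ∧ a ≤ n
    · obtain ⟨i, hi⟩ := e.surjective ⟨a, ha⟩
      obtain rfl : (e i : ℤ) = a := by rw [hi]
      rw [hin]
      have := (e (ρ i)).2
      omega
    · rw [hout a ha]
  refine ⟨oddExtension p hp, oddExtension_mem_SnSet p hp fun a ha => hout a (by omega), ?_⟩
  refine MonotoneOn.strictMonoOn_of_injOn ?_ (Equiv.injective _).injOn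
  have happ : ∀ i, (τ * oddExtension p hp) (e i) = τ (e (ρ i)) := fun i => by
    have h : 0 < (e i : ℤ) := by have := (e i).2; omega
    simp only [Equiv.Perm.mul_apply, oddExtension, Equiv.coe_fn_mk, if_pos h, hin]
  intro a ha b hb hab
  obtain ⟨i, hi⟩ := e.surjective ⟨a, ha⟩
  obtain ⟨j, hj⟩ := e.surjective ⟨b, hb⟩
  obtain rfl : (e i : ℤ) = a := by rw [hi]
  obtain rfl : (e j : ℤ) = b := by rw [hj]
  rw [happ, happ]
  refine hmono (Fin.le_def.2 ?_)
  simp only [e, finEquivIcc, Equiv.coe_fn_mk] at hab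
  omega

/-- The signed permutation changing the sign of exactly the integers with absolute value in `J`. -/
def signFlip (J : Finset ℕ) : Equiv.Perm ℤ :=
  Function.Involutive.toPerm (fun a => if a.natAbs ∈ J then -a else a) fun a => by
    by_cases h : a.natAbs ∈ J <;> simp [h]

theorem signFlip_apply (J : Finset ℕ) (a : ℤ) :
    signFlip J a = if a.natAbs ∈ J then -a else a := rfl

theorem signFlip_inv (J : Finset ℕ) : (signFlip J)⁻¹ = signFlip J := rfl

theorem isSignedPerm_signFlip {n : ℕ} {J : Finset ℕ} (hJ : J ⊆ Finset.Icc 1 n) :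
    IsSignedPerm n (signFlip J) := by
  refine ⟨fun a => ?_, fun a ha => if_neg fun h => ?_⟩
  · simp only [signFlip_apply, Int.natAbs_neg]
    split_ifs <;> rfl
  · have := Finset.mem_Icc.1 (hJ h)
    rw [Int.abs_eq_natAbs] at ha
    omega

/-- The set of absolute values of the negative window entries of `π`. -/
def negValues (n : ℕ) (π : Equiv.Perm ℤ) : Finset ℕ :=
  (NegSet n π).image fun i : ℕ => (π (i : ℤ)).natAbs

theorem injOn_natAbs_NegSet (n : ℕ) (π : Equiv.Perm ℤ) :
    Set.InjOn (fun i : ℕ => (π (i : ℤ)).natAbs) (NegSet n π) := by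
  intro i hi j hj hij
  have h1 := (Finset.mem_filter.1 hi).2
  have h2 := (Finset.mem_filter.1 hj).2
  simp only at hij
  exact_mod_cast π.injective (show π (i : ℤ) = π (j : ℤ) by omega)

theorem card_negValues (n : ℕ) (π : Equiv.Perm ℤ) : (negValues n π).card = negStat n π :=
  Finset.card_image_of_injOn (injOn_natAbs_NegSet n π)

theorem sum_negValues (n : ℕ) (π : Equiv.Perm ℤ) : ∑ k ∈ negValues n π, k = negSum n π :=
  Finset.sum_image (injOn_natAbs_NegSet n π)

theorem mem_negValues {n : ℕ} {π : Equiv.Perm ℤ} (hπ : IsSignedPerm n π) {k : ℕ} :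
    k ∈ negValues n π ↔ k ∈ Finset.Icc 1 n ∧ π⁻¹ (k : ℤ) < 0 := by
  simp only [negValues, NegSet, Finset.mem_image, Finset.mem_filter, Finset.mem_Icc]
  constructor
  · rintro ⟨i, ⟨⟨hi1, hin⟩, hneg⟩, rfl⟩
    have habs := hπ.abs_map_le (a := (i : ℤ)) (by rw [Nat.abs_cast]; omega)
    rw [Int.abs_eq_natAbs] at habs
    refine ⟨by omega, ?_⟩
    rw [Int.ofNat_natAbs_of_nonpos hneg.le, ← hπ.1, Equiv.Perm.inv_def, Equiv.symm_apply_apply]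
    omega
  · rintro ⟨hk, hneg⟩
    have habs := hπ.inv.abs_map_le (a := (k : ℤ)) (by rw [Nat.abs_cast]; omega)
    rw [Int.abs_eq_natAbs] at habs
    have h : π ((π⁻¹ (k : ℤ)).natAbs : ℤ) = -k := by
      rw [Int.ofNat_natAbs_of_nonpos hneg.le, hπ.1, Equiv.Perm.inv_def, Equiv.apply_symm_apply]
    exact ⟨(π⁻¹ (k : ℤ)).natAbs, ⟨by omega, by omega⟩, by omega⟩

theorem negValues_signFlip_mul {n : ℕ} {J : Finset ℕ} (hJ : J ⊆ Finset.Icc 1 n)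
    {u : Equiv.Perm ℤ} (hu : u ∈ SnSet n) : negValues n (signFlip J * u) = J := by
  ext k
  rw [mem_negValues ((isSignedPerm_signFlip hJ).mul hu.1), mul_inv_rev, Equiv.Perm.mul_apply,
    signFlip_inv, signFlip_apply, Int.natAbs_natCast]
  have hinv := inv_mem_SnSet hu
  by_cases hk : k ∈ J
  · have hk1 := Finset.mem_Icc.1 (hJ hk)
    have := (map_pos_iff_of_mem_SnSet hinv (a := (k : ℤ))).2 (by omega)
    rw [if_pos hk, hinv.1.1]
    simp only [hJ hk, hk, true_and, iff_true]
    omega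
  · simp only [hk, if_false, iff_false, not_and, not_lt]
    intro hk1
    have := Finset.mem_Icc.1 hk1
    exact ((map_pos_iff_of_mem_SnSet hinv (a := (k : ℤ))).2 (by omega)).le

theorem signFlip_negValues_mul_mem_SnSet {n : ℕ} {π : Equiv.Perm ℤ} (hπ : IsSignedPerm n π) :
    signFlip (negValues n π) * π ∈ SnSet n := by
  have hsub : negValues n π ⊆ Finset.Icc 1 n := fun k hk => ((mem_negValues hπ).1 hk).1
  refine ⟨(isSignedPerm_signFlip hsub).mul hπ, fun i hi => ?_⟩
  have hi1 := Finset.mem_Icc.1 hi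
  have hne := hπ.map_ne_zero (a := (i : ℤ)) (by omega)
  rw [Equiv.Perm.mul_apply, signFlip_apply]
  rcases hne.lt_or_gt with hneg | hpos
  · have hmem : (π (i : ℤ)).natAbs ∈ negValues n π :=
      Finset.mem_image_of_mem _ (Finset.mem_filter.2 ⟨hi, hneg⟩)
    rw [if_pos hmem]
    omega
  · rw [if_neg fun h => ?_]
    · exact hpos
    · have := ((mem_negValues hπ).1 h).2
      rw [Int.natAbs_of_nonneg hpos.le, Equiv.Perm.inv_def, Equiv.symm_apply_apply] at this
      omega

theorem DesA_mul_of_strictMonoOn {n : ℕ} {σ u : Equiv.Perm ℤ}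
    (hσ : StrictMonoOn σ (Set.Icc (1 : ℤ) n)) (hu : u ∈ SnSet n) :
    DesA n (σ * u) = DesA n u := by
  refine Finset.filter_congr fun i hi => ?_
  have hi1 := Finset.mem_Icc.1 hi
  exact hσ.lt_iff_lt (map_mem_Icc_of_mem_SnSet hu ⟨by omega, by omega⟩)
    (map_mem_Icc_of_mem_SnSet hu ⟨by omega, by omega⟩)

theorem stmt_8 (n : ℕ) (hn : 1 ≤ n) :
    (∑ᶠ π ∈ BSet n, (MvPolynomial.X 0 : MvPolynomial (Fin 2) ℤ) ^ ndes n π *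
        MvPolynomial.X 1 ^ nmaj n π) =
    (∏ i ∈ Finset.Icc 1 n, (1 + MvPolynomial.X 0 * MvPolynomial.X 1 ^ i)) *
    ∑ᶠ u ∈ SnSet n, (MvPolynomial.X 0 : MvPolynomial (Fin 2) ℤ) ^ desA n u *
        MvPolynomial.X 1 ^ majA n u := by
  have hB := finite_BSet n
  have hS := hB.subset (SnSet_subset_BSet n)
  rw [finsum_mem_eq_finite_toFinset_sum _ hB, finsum_mem_eq_finite_toFinset_sum _ hS,
    Finset.prod_one_add, Finset.sum_mul_sum, ← Finset.sum_product']
  choose r hr hmono using fun J => exists_mem_SnSet_strictMonoOn n (signFlip J)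
  have hneg : ∀ J ⊆ Finset.Icc 1 n, ∀ u ∈ SnSet n, negValues n (signFlip J * r J * u) = J :=
    fun J hJ u hu => by rw [mul_assoc, negValues_signFlip_mul hJ (mul_mem_SnSet (hr J) hu)]
  symm
  refine Finset.sum_nbij' (fun x => signFlip x.1 * r x.1 * x.2)
    (fun π => (negValues n π, (signFlip (negValues n π) * r (negValues n π))⁻¹ * π))
    ?_ ?_ ?_ ?_ ?_
  · rintro ⟨J, u⟩ h
    simp only [Finset.mem_product, Finset.mem_powerset, Set.Finite.mem_toFinset] at h ⊢
    exact ((isSignedPerm_signFlip h.1).mul (hr J).1).mul h.2.1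
  · intro π hπ
    simp only [Finset.mem_product, Finset.mem_powerset, Set.Finite.mem_toFinset] at hπ ⊢
    refine ⟨fun k hk => ((mem_negValues hπ).1 hk).1, ?_⟩
    rw [mul_inv_rev, mul_assoc, signFlip_inv]
    exact mul_mem_SnSet (inv_mem_SnSet (hr _)) (signFlip_negValues_mul_mem_SnSet hπ)
  · rintro ⟨J, u⟩ h
    simp only [Finset.mem_product, Finset.mem_powerset, Set.Finite.mem_toFinset] at h
    simp only [hneg J h.1 u h.2, inv_mul_cancel_left]
  · intro π _
    simp only [mul_inv_cancel_left]
  · rintro ⟨J, u⟩ h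
    simp only [Finset.mem_product, Finset.mem_powerset, Set.Finite.mem_toFinset] at h
    have hdes := DesA_mul_of_strictMonoOn (hmono J) h.2
    simp only [ndes, nmaj, desA, majA, hdes, ← card_negValues, ← sum_negValues, hneg J h.1 u h.2,
      Finset.prod_mul_distrib, Finset.prod_const, Finset.prod_pow_eq_pow_sum J fun i => i]
    ring
end

section
/- For σ ∈ B_{n−1} (n ≥ 2), Σ_{i ∈ [2,n−1], σ(i−1) < σ(i)} q^{2(d_i(σ) + i)} = Σ_{k=1}^{a} q^{2(n−k)}, where d_i(σ) = #{j ∈ Des_A(σ) : j ≥ i} and a = n − 2 − des_A(σ) is the number of indices i ∈ [2,n−1] with σ(i−1) < σ(i). -/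
open Finset

/-- `d_i(σ) = #{j ∈ Des_A(σ) : j ≥ i}`, the number of descents from position `i` on. -/
def dFrom (n : ℕ) (σ : Equiv.Perm ℤ) (i : ℕ) : ℕ :=
  ((DesA n σ).filter (fun j => i ≤ j)).card

theorem sum_ascents_card_descents_add {M : Type*} [AddCommMonoid M] (P : ℕ → Prop)
    [DecidablePred P] (m : ℕ) (g : ℕ → M) :
    ∑ j ∈ (Finset.Icc 1 m).filter (fun j => ¬ P j),
        g (((Finset.Icc (j + 1) m).filter P).card + (j + 1)) =
      ∑ k ∈ Finset.Icc 1 (m - ((Finset.Icc 1 m).filter P).card), g (m + 2 - k) := by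
  induction m generalizing g with
  | zero => simp
  | succ m ih =>
    have hIcc : ∀ a, a ≤ m + 1 → Finset.Icc a (m + 1) = insert (m + 1) (Finset.Icc a m) :=
      fun a ha => by
        ext x
        simp only [Finset.mem_insert, Finset.mem_Icc]
        omega
    have hle : ((Finset.Icc 1 m).filter P).card ≤ m := by
      simpa using Finset.card_filter_le (Finset.Icc 1 m) P
    rw [hIcc 1 (by omega)]
    by_cases h : P (m + 1)
    · rw [Finset.filter_insert, if_neg (not_not.2 h), Finset.filter_insert, if_pos h,
        Finset.card_insert_of_notMem (by simp), Nat.add_sub_add_right]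
      refine Eq.trans ?_ ((ih fun x => g (x + 1)).trans ?_)
      · refine Finset.sum_congr rfl fun j hj => ?_
        simp only [Finset.mem_filter, Finset.mem_Icc] at hj
        rw [hIcc (j + 1) (by omega), Finset.filter_insert, if_pos h,
          Finset.card_insert_of_notMem (by simp)]
        congr 1
        omega
      · refine Finset.sum_congr rfl fun k hk => ?_
        simp only [Finset.mem_Icc] at hk
        congr 1
        omega
    · rw [Finset.filter_insert, if_pos h, Finset.filter_insert, if_neg h,
        Finset.sum_insert (by simp), Nat.succ_sub hle, Nat.succ_eq_add_one,
        ← Finset.add_sum_Ioc_eq_sum_Icc (by omega)]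
      congr 1
      · simp
      · refine Eq.trans (Finset.sum_congr rfl fun j hj => ?_) ((ih g).trans ?_)
        · simp only [Finset.mem_filter, Finset.mem_Icc] at hj
          rw [hIcc (j + 1) (by omega), Finset.filter_insert, if_neg h]
        · refine Finset.sum_bij (fun k _ => k + 1) ?_ ?_ ?_ ?_
          · intro k hk
            simp only [Finset.mem_Icc, Finset.mem_Ioc] at hk ⊢
            omega
          · intro a _ b _ hab
            omega
          · intro b hb
            simp only [Finset.mem_Ioc] at hb
            exact ⟨b - 1, by simp only [Finset.mem_Icc]; omega, by omega⟩
          · intro k _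
            congr 1
            omega

theorem stmt_13 (n : ℕ) (hn : 2 ≤ n) (σ : Equiv.Perm ℤ) (hσ : IsSignedPerm (n - 1) σ) :
    (∑ i ∈ (Finset.Icc 2 (n - 1)).filter (fun i : ℕ => σ ((i : ℤ) - 1) < σ (i : ℤ)),
        (Polynomial.X : Polynomial ℤ) ^ (2 * (dFrom (n - 1) σ i + i))) =
    ∑ k ∈ Finset.Icc 1 (n - 2 - desA (n - 1) σ),
        (Polynomial.X : Polynomial ℤ) ^ (2 * (n - k)) := by
  obtain ⟨m, rfl⟩ : ∃ m, n = m + 2 := ⟨n - 2, by omega⟩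
  have hsum := sum_ascents_card_descents_add
    (fun j : ℕ => σ ((j : ℤ) + 1) < σ (j : ℤ)) m
    fun x => (Polynomial.X : Polynomial ℤ) ^ (2 * x)
  refine Eq.trans (Eq.symm ?_) hsum
  refine Finset.sum_bij (fun j _ => j + 1) ?_ ?_ ?_ ?_
  · intro j hj
    simp only [Finset.mem_filter, Finset.mem_Icc, not_lt] at hj ⊢
    refine ⟨by omega, ?_⟩
    push_cast
    rw [add_sub_cancel_right]
    exact lt_of_le_of_ne hj.2 fun h => by
      have := σ.injective h
      omega
  · intro a _ b _ hab
    omega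
  · intro i hi
    simp only [Finset.mem_filter, Finset.mem_Icc] at hi
    obtain ⟨j, rfl⟩ : ∃ j, i = j + 1 := ⟨i - 1, by omega⟩
    refine ⟨j, ?_, rfl⟩
    have h := hi.2
    push_cast at h
    rw [add_sub_cancel_right] at h
    simp only [Finset.mem_filter, Finset.mem_Icc, not_lt]
    exact ⟨by omega, h.le⟩
  · intro j _
    have hset : (Finset.Icc (j + 1) m).filter (fun l : ℕ => σ ((l : ℤ) + 1) < σ (l : ℤ)) =
        (DesA (m + 2 - 1) σ).filter (fun l => j + 1 ≤ l) := by
      ext l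
      simp only [DesA, Finset.mem_filter, Finset.mem_Icc]
      constructor
      · rintro ⟨h, h'⟩
        exact ⟨⟨by omega, h'⟩, h.1⟩
      · rintro ⟨⟨h, h'⟩, h''⟩
        exact ⟨by omega, h'⟩
    simp only [dFrom, hset]
end

section
/- For every n ≥ 1, the polynomials S_n(t,q) = Σ_{π ∈ B_n} t^{fd(π)} q^{fmaj(π)} satisfy the recursion S_n(t,q) = (1 + tq + t²q²·[2n−2]_q)·S_{n−1}(t,q) + tq(1−t)(1+tq)·δ_t(S_{n−1}(t,q)), where S_0(t,q) = 1. -/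
open Finset

/-- `S_n(t,q) = Σ_{π ∈ B_n} t^{fd(π)} q^{fmaj(π)}`, as an element of `ℚ[q][t]`
(outer variable `t`, inner variable `q`). -/
noncomputable def SnPoly (n : ℕ) : Polynomial (Polynomial ℚ) :=
  ∑ᶠ π ∈ BSet n, (Polynomial.X : Polynomial (Polynomial ℚ)) ^ fd n π *
    Polynomial.C (Polynomial.X ^ fmaj n π)

/-- The signed permutation whose window is `1, …, j, ±(n+1), j+1, …, n` (for `j ≤ n`), with the sign
`-` exactly when `b` is true. Composing `π ∈ B_n` with it inserts the letter `±(n+1)` after the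
`j`-th letter of the window of `π`. -/
def insertionPerm (n j : ℕ) (b : Bool) : Equiv.Perm ℤ where
  toFun a :=
    if a = min (j : ℤ) n + 1 then (if b then -(n + 1) else n + 1 : ℤ)
    else if a = -(min (j : ℤ) n + 1) then (if b then n + 1 else -(n + 1) : ℤ)
    else if min (j : ℤ) n + 1 < a ∧ a ≤ n + 1 then a - 1
    else if -(n + 1 : ℤ) ≤ a ∧ a < -(min (j : ℤ) n + 1) then a + 1
    else a
  invFun a :=
    if a = (if b then -(n + 1) else n + 1 : ℤ) then min (j : ℤ) n + 1
    else if a = (if b then n + 1 else -(n + 1) : ℤ) then -(min (j : ℤ) n + 1)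
    else if min (j : ℤ) n + 1 ≤ a ∧ a ≤ n then a + 1
    else if -(n : ℤ) ≤ a ∧ a ≤ -(min (j : ℤ) n + 1) then a - 1
    else a
  left_inv a := by
    have h : min (j : ℤ) n ≤ n := min_le_right _ _
    have h' : 0 ≤ min (j : ℤ) n := by omega
    generalize min (j : ℤ) n = p at h h' ⊢
    cases b <;> simp only [Bool.false_eq_true, if_false, if_true] <;> split_ifs <;> omega
  right_inv a := by
    have h : min (j : ℤ) n ≤ n := min_le_right _ _
    have h' : 0 ≤ min (j : ℤ) n := by omega
    generalize min (j : ℤ) n = p at h h' ⊢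
    cases b <;> simp only [Bool.false_eq_true, if_false, if_true] <;> split_ifs <;> omega

theorem insertionPerm_apply (n j : ℕ) (b : Bool) (a : ℤ) :
    insertionPerm n j b a =
      if a = min (j : ℤ) n + 1 then (if b then -(n + 1) else n + 1 : ℤ)
      else if a = -(min (j : ℤ) n + 1) then (if b then n + 1 else -(n + 1) : ℤ)
      else if min (j : ℤ) n + 1 < a ∧ a ≤ n + 1 then a - 1
      else if -(n + 1 : ℤ) ≤ a ∧ a < -(min (j : ℤ) n + 1) then a + 1
      else a := rfl

theorem insertionPerm_neg (n j : ℕ) (b : Bool) (a : ℤ) :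
    insertionPerm n j b (-a) = -insertionPerm n j b a := by
  simp only [insertionPerm_apply]
  cases b <;> grind

theorem IsSignedPerm.abs_apply_le {n : ℕ} {π : Equiv.Perm ℤ} (h : IsSignedPerm n π) {a : ℤ}
    (ha : |a| ≤ n) : |π a| ≤ n := by
  by_contra! hlt
  have := π.injective (h.2 _ hlt)
  rw [this] at hlt
  omega

theorem IsSignedPerm.mul_insertionPerm {n : ℕ} {π : Equiv.Perm ℤ} (h : IsSignedPerm n π) (j : ℕ)
    (b : Bool) : IsSignedPerm (n + 1) (π * insertionPerm n j b) := by
  refine ⟨fun a => ?_, fun a ha => ?_⟩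
  · simp [insertionPerm_neg, h.1]
  · have : insertionPerm n j b a = a := by
      rw [insertionPerm_apply]
      grind
    rw [Equiv.Perm.mul_apply, this]
    exact h.2 a (by push_cast at ha; omega)

/-- The parameters of the insertions taking `B_n` to `B_{n+1}`. -/
def insertionData (n : ℕ) : Set (Equiv.Perm ℤ × ℕ × Bool) :=
  BSet n ×ˢ (↑(range (n + 1) ×ˢ (univ : Finset Bool)) : Set (ℕ × Bool))

theorem bijOn_insertion (n : ℕ) :
    Set.BijOn (fun x : Equiv.Perm ℤ × ℕ × Bool => x.1 * insertionPerm n x.2.1 x.2.2)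
      (insertionData n) (BSet (n + 1)) := by
  refine ⟨?_, ?_, ?_⟩
  · rintro ⟨π, j, b⟩ ⟨h, -⟩
    exact IsSignedPerm.mul_insertionPerm h j b
  · rintro ⟨π, j, b⟩ ⟨h, hj⟩ ⟨π', j', b'⟩ ⟨h', hj'⟩ heq
    simp only [coe_product, Set.mem_prod, mem_coe, mem_range, mem_univ, and_true] at hj hj' h h' heq
    have key : insertionPerm n j' b' (j + 1) = insertionPerm n j b (j + 1) := by
      have h1 := congrArg (fun σ : Equiv.Perm ℤ => σ (j + 1)) heq
      have hN : insertionPerm n j b (j + 1) = if b then -(n + 1 : ℤ) else n + 1 := by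
        rw [insertionPerm_apply, if_pos (by omega)]
      have h2 : ∀ σ, IsSignedPerm n σ → σ (if b then -(n + 1 : ℤ) else n + 1) =
          if b then -(n + 1 : ℤ) else n + 1 := by
        intro σ hσ
        apply hσ.2
        cases b <;> grind
      simp only [Equiv.Perm.mul_apply, hN, h2 π h] at h1
      rw [hN]
      apply π'.injective
      rw [h2 π' h', h1]
    have hjb : j = j' ∧ b = b' := by
      simp only [insertionPerm_apply] at key
      cases b <;> cases b' <;> grind
    obtain ⟨rfl, rfl⟩ := hjb
    rw [mul_right_cancel heq]
  · intro π h
    have h0 : π 0 = 0 := by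
      have := h.1 0
      simp only [neg_zero] at this
      omega
    set a := π.symm (n + 1) with ha
    have hπa : π a = n + 1 := by simp [ha]
    have ha0 : a ≠ 0 := by
      intro h1
      rw [h1, h0] at hπa
      omega
    have han : |a| ≤ n + 1 := by
      by_contra! hlt
      have := h.2 a (by push_cast; exact hlt)
      rw [hπa] at this
      grind
    obtain ⟨han1, han2⟩ := abs_le.1 han
    obtain ⟨j, b, hj, hc⟩ : ∃ (j : ℕ) (b : Bool), j < n + 1 ∧ insertionPerm n j b a = n + 1 := by
      refine ⟨a.natAbs - 1, decide (a < 0), by grind, ?_⟩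
      rw [insertionPerm_apply]
      rcases lt_or_gt_of_ne ha0 with h1 | h1
      · rw [if_neg (by omega), if_pos (by omega)]
        simp [h1]
      · rw [if_pos (by omega)]
        simp [h1.le]
    have hodd : ∀ x, (insertionPerm n j b)⁻¹ (-x) = -(insertionPerm n j b)⁻¹ x := by
      intro x
      rw [Equiv.Perm.inv_eq_iff_eq, insertionPerm_neg]
      simp
    have hinv : (insertionPerm n j b)⁻¹ (n + 1) = a := by
      rw [Equiv.Perm.inv_eq_iff_eq, hc]
    refine ⟨(π * (insertionPerm n j b)⁻¹, j, b), ⟨⟨fun x => ?_, fun x hx => ?_⟩, by simpa using hj⟩,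
      by simp⟩
    · simp only [Equiv.Perm.mul_apply, hodd, h.1]
    · rw [Equiv.Perm.mul_apply]
      have hcases : x = n + 1 ∨ x = -(n + 1) ∨ (n + 1 : ℤ) < |x| := by grind
      rcases hcases with rfl | rfl | hx'
      · rw [hinv, hπa]
      · rw [hodd, hinv, h.1, hπa]
      · have : (insertionPerm n j b)⁻¹ x = x := by
          rw [Equiv.Perm.inv_eq_iff_eq, insertionPerm_apply]
          grind
        rw [this]
        exact h.2 x (by push_cast; exact hx')

theorem BSet_zero : BSet 0 = {1} := by
  ext π
  simp only [BSet, IsSignedPerm, Set.mem_ofPred_eq, Set.mem_singleton_iff]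
  constructor
  · rintro ⟨h1, h2⟩
    ext a
    rcases eq_or_ne a 0 with rfl | ha
    · have := h1 0
      simp only [neg_zero] at this
      simp only [Equiv.Perm.coe_one, id_eq]
      omega
    · exact h2 a (by simpa using ha)
  · rintro rfl
    simp

theorem finsum_mem_BSet_succ {M : Type*} [AddCommMonoid M] (n : ℕ) (f : Equiv.Perm ℤ → M) :
    ∑ᶠ π ∈ BSet (n + 1), f π =
      ∑ π ∈ (finite_BSet n).toFinset, ∑ j ∈ range (n + 1),
        (f (π * insertionPerm n j false) + f (π * insertionPerm n j true)) := by
  rw [← finsum_mem_eq_of_bijOn _ (bijOn_insertion n) (fun _ _ => rfl)]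
  have : insertionData n =
      ↑((finite_BSet n).toFinset ×ˢ (range (n + 1) ×ˢ (univ : Finset Bool))) := by
    simp [insertionData]
  rw [this, finsum_mem_coe_finset, sum_product]
  simp only [sum_product, Fintype.sum_bool, add_comm]

theorem DesA_succ {m : ℕ} (hm : 1 ≤ m) (π : Equiv.Perm ℤ) :
    DesA (m + 1) π = if π (m + 1) < π m then insert m (DesA m π) else DesA m π := by
  obtain ⟨m, rfl⟩ := Nat.exists_eq_add_of_le' hm
  simp only [DesA, Nat.add_sub_cancel]
  rw [← insert_Icc_right_eq_Icc_add_one (by omega), filter_insert]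

theorem notMem_DesA (m : ℕ) (π : Equiv.Perm ℤ) : m ∉ DesA m π := by
  simp only [DesA, mem_filter, mem_Icc]
  omega

theorem fd_succ {m : ℕ} (hm : 1 ≤ m) (π : Equiv.Perm ℤ) :
    fd (m + 1) π = fd m π + if π (m + 1) < π m then 2 else 0 := by
  simp only [fd, desA, DesA_succ hm]
  split_ifs <;> simp [notMem_DesA] <;> ring

theorem fmaj_succ {m : ℕ} (hm : 1 ≤ m) (π : Equiv.Perm ℤ) :
    fmaj (m + 1) π = fmaj m π + (if π (m + 1) < π m then 2 * m else 0) +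
      if π (m + 1) < 0 then 1 else 0 := by
  have hneg : negStat (m + 1) π = negStat m π + if π (m + 1) < 0 then 1 else 0 := by
    simp only [negStat, NegSet]
    rw [← insert_Icc_right_eq_Icc_add_one (by omega), filter_insert]
    push_cast
    split_ifs <;> simp
  simp only [fmaj, majA, DesA_succ hm, hneg]
  split_ifs <;> simp [notMem_DesA] <;> ring

theorem fd_one (π : Equiv.Perm ℤ) : fd 1 π = if π 1 < 0 then 1 else 0 := by
  simp [fd, desA, DesA]

theorem fmaj_one (π : Equiv.Perm ℤ) : fmaj 1 π = if π 1 < 0 then 1 else 0 := by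
  simp only [fmaj, majA, DesA, negStat, NegSet]
  by_cases h : π 1 < 0 <;> simp [h, filter_singleton]

theorem fd_congr {m : ℕ} (hm : 1 ≤ m) {π τ : Equiv.Perm ℤ}
    (h : ∀ i : ℕ, 1 ≤ i → i ≤ m → π i = τ i) : fd m π = fd m τ := by
  induction m, hm using Nat.le_induction with
  | base =>
    have := h 1 le_rfl le_rfl
    push_cast at this
    rw [fd_one, fd_one, this]
  | succ m hm ih =>
    have h1 := h m hm (by omega)
    have h2 := h (m + 1) (by omega) le_rfl
    push_cast at h2
    rw [fd_succ hm, fd_succ hm, ih fun i hi him => h i hi (by omega), h1, h2]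

theorem fmaj_congr {m : ℕ} (hm : 1 ≤ m) {π τ : Equiv.Perm ℤ}
    (h : ∀ i : ℕ, 1 ≤ i → i ≤ m → π i = τ i) : fmaj m π = fmaj m τ := by
  induction m, hm using Nat.le_induction with
  | base =>
    have := h 1 le_rfl le_rfl
    push_cast at this
    rw [fmaj_one, fmaj_one, this]
  | succ m hm ih =>
    have h1 := h m hm (by omega)
    have h2 := h (m + 1) (by omega) le_rfl
    push_cast at h2
    rw [fmaj_succ hm, fmaj_succ hm, ih fun i hi him => h i hi (by omega), h1, h2]

section Insertion

variable {n : ℕ} (π : Equiv.Perm ℤ) {j : ℕ} (b : Bool)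

theorem mul_insertionPerm_of_le (hj : j ≤ n) {i : ℕ} (hi : 1 ≤ i) (hij : i ≤ j) :
    (π * insertionPerm n j b) i = π i := by
  rw [Equiv.Perm.mul_apply, insertionPerm_apply]
  grind

theorem mul_insertionPerm_of_lt {i : ℕ} (hij : j < i) (hi : i ≤ n) :
    (π * insertionPerm n j b) (i + 1) = π i := by
  rw [Equiv.Perm.mul_apply, insertionPerm_apply]
  grind

theorem mul_insertionPerm_self (hπ : IsSignedPerm n π) (hj : j ≤ n) :
    (π * insertionPerm n j b) (j + 1) = if b then -(n + 1 : ℤ) else n + 1 := by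
  rw [Equiv.Perm.mul_apply, insertionPerm_apply, if_pos (by omega)]
  apply hπ.2
  cases b <;> grind

end Insertion

section Weight

variable {R : Type*} [CommRing R] (t q : R)

/-- The monomial `t^{fd(π)} q^{fmaj(π)}` of a window of length `m`. -/
def flagWeight (m : ℕ) (π : Equiv.Perm ℤ) : R := t ^ fd m π * q ^ fmaj m π

theorem flagWeight_succ {m : ℕ} (hm : 1 ≤ m) (π : Equiv.Perm ℤ) :
    flagWeight t q (m + 1) π = flagWeight t q m π *
      (if π (m + 1) < π m then t ^ 2 * q ^ (2 * m) else 1) * (if π (m + 1) < 0 then q else 1) := by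
  simp only [flagWeight, fd_succ hm, fmaj_succ hm]
  split_ifs <;> ring

theorem flagWeight_one (π : Equiv.Perm ℤ) :
    flagWeight t q 1 π = if π 1 < 0 then t * q else 1 := by
  simp only [flagWeight, fd_one, fmaj_one]
  split_ifs <;> simp

theorem flagWeight_congr {m : ℕ} (hm : 1 ≤ m) {π τ : Equiv.Perm ℤ}
    (h : ∀ i : ℕ, 1 ≤ i → i ≤ m → π i = τ i) : flagWeight t q m π = flagWeight t q m τ := by
  rw [flagWeight, flagWeight, fd_congr hm h, fmaj_congr hm h]

variable {n : ℕ} {π : Equiv.Perm ℤ}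

theorem IsSignedPerm.bounds (hπ : IsSignedPerm n π) {i : ℕ} (hi : i ≤ n) :
    -(n + 1 : ℤ) < π i ∧ π i < n + 1 := by
  have := hπ.abs_apply_le (a := i) (by simpa using hi)
  grind

theorem flagWeight_insertion_end (hπ : IsSignedPerm n π) {m : ℕ} (hm : 1 ≤ m)
    (hmn : m ≤ n) (b : Bool) :
    flagWeight t q (m + 1) (π * insertionPerm n m b) =
      flagWeight t q m π * if b then t ^ 2 * q ^ (2 * m + 1) else 1 := by
  have hb := hπ.bounds hmn
  rw [flagWeight_succ t q hm, mul_insertionPerm_self π b hπ hmn,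
    mul_insertionPerm_of_le π b hmn hm le_rfl,
    flagWeight_congr t q hm fun i hi him => mul_insertionPerm_of_le π b hmn hi him]
  cases b
  · rw [if_neg (by simp; omega), if_neg (by simp; omega)]
    simp
  · rw [if_pos (by simp; omega), if_pos (by simp; omega)]
    simp only [if_true]
    ring

theorem flagWeight_insertion_before_last (hπ : IsSignedPerm n π) {m : ℕ} (hm : 1 ≤ m)
    (hmn : m + 1 ≤ n) (b : Bool) :
    flagWeight t q (m + 2) (π * insertionPerm n m b) =
      flagWeight t q m π * (if b then t ^ 2 * q ^ (2 * m + 1) else t ^ 2 * q ^ (2 * m + 2)) *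
        if π (m + 1) < 0 then q else 1 := by
  have hb := hπ.bounds hmn
  have h1 := mul_insertionPerm_self π b hπ (show m ≤ n by omega)
  have h2 := mul_insertionPerm_of_lt π b (show m < m + 1 by omega) hmn
  simp only [Nat.cast_add, Nat.cast_one] at h2 hb
  rw [flagWeight_succ t q (show 1 ≤ m + 1 by omega),
    flagWeight_insertion_end t q hπ hm (by omega)]
  simp only [Nat.cast_add, Nat.cast_one]
  rw [h1, h2]
  cases b
  · rw [if_pos (show π (m + 1) < _ by simp; omega)]
    simp only [Bool.false_eq_true, if_false]
    ring
  · rw [if_neg (show ¬ π (m + 1) < _ by simp; omega)]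
    simp

theorem flagWeight_insertion_succ {m j : ℕ} (hj : j < m) (hmn : m + 1 ≤ n) (b : Bool) :
    flagWeight t q (m + 2) (π * insertionPerm n j b) =
      flagWeight t q (m + 1) (π * insertionPerm n j b) *
        (if π (m + 1) < π m then t ^ 2 * q ^ (2 * m + 2) else 1) *
        if π (m + 1) < 0 then q else 1 := by
  have h1 := mul_insertionPerm_of_lt π b hj (show m ≤ n by omega)
  have h2 := mul_insertionPerm_of_lt π b (show j < m + 1 by omega) hmn
  simp only [Nat.cast_add, Nat.cast_one] at h2
  rw [flagWeight_succ t q (show 1 ≤ m + 1 by omega)]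
  simp only [Nat.cast_add, Nat.cast_one]
  rw [h1, h2]
  simp only [mul_add, mul_one]

theorem sum_flagWeight_insertion_init (hπ : IsSignedPerm n π) {m : ℕ} (hm : 1 ≤ m)
    (hmn : m ≤ n) :
    (1 - q) * ∑ j ∈ range m, (flagWeight t q (m + 1) (π * insertionPerm n j false) +
        flagWeight t q (m + 1) (π * insertionPerm n j true)) =
      flagWeight t q m π * (q - q ^ (fd m π + 1) + t * (1 - q) * q ^ (fd m π + 1) +
        t ^ 2 * (q ^ (fd m π + 2) - q ^ (2 * m + 1))) := by
  induction m, hm using Nat.le_induction with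
  | base =>
    have hb := hπ.bounds hmn
    have h1 := fun b => mul_insertionPerm_self π b hπ (Nat.zero_le n)
    have h2 := fun b => mul_insertionPerm_of_lt π b one_pos hmn
    simp only [Nat.cast_zero, Nat.cast_one, zero_add] at h1 h2 hb
    simp only [range_one, sum_singleton, flagWeight_succ t q le_rfl, flagWeight_one, fd_one,
      Nat.cast_one, h1, h2]
    simp only [Bool.false_eq_true, if_false, if_true, hb.2, not_lt.2 hb.1.le]
    rw [if_neg (show ¬ (n + 1 : ℤ) < 0 by omega), if_pos (show (-(n + 1 : ℤ)) < 0 by omega)]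
    split_ifs <;> ring
  | succ m hm ih =>
    specialize ih (by omega)
    rw [sum_range_succ, flagWeight_insertion_before_last t q hπ hm hmn,
      flagWeight_insertion_before_last t q hπ hm hmn,
      sum_congr rfl fun j hj => by
        rw [flagWeight_insertion_succ t q (mem_range.1 hj) hmn,
          flagWeight_insertion_succ t q (mem_range.1 hj) hmn, ← add_mul, ← add_mul],
      ← sum_mul, ← sum_mul, mul_add, ← mul_assoc, ← mul_assoc, ih, fd_succ hm,
      flagWeight_succ t q hm]
    simp only [Bool.false_eq_true, if_false, if_true]
    generalize (if π (m + 1) < 0 then q else 1) = r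
    split_ifs <;> ring

theorem sum_flagWeight_insertion (hπ : IsSignedPerm n π) :
    (1 - q) * ∑ j ∈ range (n + 1), (flagWeight t q (n + 1) (π * insertionPerm n j false) +
        flagWeight t q (n + 1) (π * insertionPerm n j true)) =
      flagWeight t q n π * (1 - q ^ (fd n π + 1) + t * (1 - q) * q ^ (fd n π + 1) +
        t ^ 2 * (q ^ (fd n π + 2) - q ^ (2 * n + 2))) := by
  rcases Nat.eq_zero_or_pos n with rfl | hn
  · obtain rfl : π = 1 := by
      have : π ∈ BSet 0 := hπ
      simpa [BSet_zero] using this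
    have h : ∀ b, insertionPerm 0 0 b 1 = if b then -1 else 1 := by
      intro b
      simp [insertionPerm_apply]
    have hfd : fd 0 1 = 0 := by simp [fd, desA, DesA]
    have hfmaj : fmaj 0 1 = 0 := by simp [fmaj, majA, DesA, negStat, NegSet]
    simp only [zero_add, range_one, sum_singleton, one_mul, flagWeight_one, h]
    simp only [flagWeight, hfd, hfmaj, Bool.false_eq_true, if_false, if_true, zero_lt_one.not_gt,
      neg_one_lt_zero]
    ring
  · rw [sum_range_succ, mul_add, sum_flagWeight_insertion_init t q hπ hn le_rfl,
      flagWeight_insertion_end t q hπ hn le_rfl, flagWeight_insertion_end t q hπ hn le_rfl]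
    simp only [Bool.false_eq_true, if_false, if_true]
    ring

end Weight

open Polynomial in
theorem SnPoly_eq_sum (n : ℕ) :
    SnPoly n = ∑ π ∈ (finite_BSet n).toFinset, flagWeight (X : ℚ[X][X]) (C X) n π := by
  rw [SnPoly, finsum_mem_eq_finite_toFinset_sum _ (finite_BSet n)]
  simp only [flagWeight, C_pow]

open Polynomial in
theorem SnPoly_succ_eq_sum (n : ℕ) :
    (1 - C X : ℚ[X][X]) * SnPoly (n + 1) = ∑ π ∈ (finite_BSet n).toFinset,
      flagWeight (X : ℚ[X][X]) (C X) n π *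
        (1 - C X ^ (fd n π + 1) + X * (1 - C X) * C X ^ (fd n π + 1) +
          X ^ 2 * (C X ^ (fd n π + 2) - C X ^ (2 * n + 2))) := by
  have h : SnPoly (n + 1) = ∑ᶠ π ∈ BSet (n + 1), flagWeight (X : ℚ[X][X]) (C X) (n + 1) π := by
    simp only [SnPoly, flagWeight, C_pow]
  rw [h, finsum_mem_BSet_succ, mul_sum]
  refine sum_congr rfl fun π hπ => ?_
  exact sum_flagWeight_insertion X (C X) ((finite_BSet n).mem_toFinset.1 hπ)

open Polynomial in
theorem SnPoly_comp (n : ℕ) :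
    (SnPoly n).comp (C X * X) =
      ∑ π ∈ (finite_BSet n).toFinset, flagWeight (X : ℚ[X][X]) (C X) n π * C X ^ fd n π := by
  rw [SnPoly_eq_sum]
  simp [flagWeight, Polynomial.comp, eval₂_finsetSum, mul_pow, eval₂_mul, eval₂_pow]
  exact sum_congr rfl fun π _ => by ring

open Polynomial in
theorem one_sub_mul_qnumQ (m : ℕ) : (1 - C X : ℚ[X][X]) * C (qnumQ m) = 1 - C X ^ m := by
  rw [← C_1, ← C_sub, ← C_mul, qnumQ, mul_neg_geom_sum, C_sub, C_pow]

theorem stmt_15 (n : ℕ) (hn : 1 ≤ n) (D : Polynomial (Polynomial ℚ))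
    (hD : (Polynomial.C Polynomial.X * Polynomial.X - Polynomial.X) * D =
      (SnPoly (n - 1)).comp (Polynomial.C Polynomial.X * Polynomial.X) - SnPoly (n - 1)) :
    SnPoly n =
      (1 + Polynomial.X * Polynomial.C Polynomial.X +
        Polynomial.X ^ 2 * Polynomial.C (Polynomial.X ^ 2) * Polynomial.C (qnumQ (2 * n - 2))) *
        SnPoly (n - 1) +
      Polynomial.X * Polynomial.C Polynomial.X * (1 - Polynomial.X) *
        (1 + Polynomial.X * Polynomial.C Polynomial.X) * D := by
  obtain ⟨n, rfl⟩ := Nat.exists_eq_add_of_le' hn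
  simp only [Nat.add_sub_cancel] at hD ⊢
  set t : Polynomial (Polynomial ℚ) := Polynomial.X with ht
  set q : Polynomial (Polynomial ℚ) := Polynomial.C Polynomial.X with hq
  have h0 : 1 - q ≠ 0 := by
    rw [hq, ← Polynomial.C_1, ← Polynomial.C_sub, Polynomial.C_ne_zero]
    intro h
    simpa using congrArg (Polynomial.eval 0) h
  have hqn := one_sub_mul_qnumQ (2 * (n + 1) - 2)
  rw [← hq] at hqn
  have hsum : (1 - q) * SnPoly (n + 1) =
      ((1 + t * q) * (1 - q) + t ^ 2 * q ^ 2 * (1 - q ^ (2 * (n + 1) - 2))) * SnPoly n +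
        q * (1 - t) * (1 + t * q) * (SnPoly n - (SnPoly n).comp (q * t)) := by
    rw [SnPoly_succ_eq_sum, SnPoly_comp, SnPoly_eq_sum, ← sum_sub_distrib, mul_sum, mul_sum,
      ← sum_add_distrib]
    refine sum_congr rfl fun π _ => ?_
    rw [← ht, ← hq, show 2 * (n + 1) - 2 = 2 * n by omega]
    ring
  apply mul_left_cancel₀ h0
  rw [hsum, Polynomial.C_pow, ← hq]
  linear_combination -(t ^ 2 * q ^ 2 * SnPoly n) * hqn + q * (1 - t) * (1 + t * q) * hD
end
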